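/- arXiv:2202.12545 — 2 statements merged into one kernel-verified Lean document; each statement's English description precedes it below -/
import Mathlib

section
/- Let T > 0, let U ⊆ ℝᵖ be a nonempty compact set, and let f : ℝⁿ × ℝ × ℝᵖ → ℝⁿ and g : ℝⁿ × ℝ × ℝᵖ → ℝ be continuously differentiable with linear growth, such that for every (x,y) the velocity set G(x,y) = {(f(x,y,u), g(x,y,u)) : u ∈ U} ⊆ ℝⁿ⁺¹ is convex. Fix (x₀,y₀) and let S_ℓ be the set of absolutely continuous Π = (x,y,z) : [0,T] → ℝⁿ⁺² with Π(0) = (x₀,y₀,y₀) such that for almost every t there exist u ∈ U and v ∈ [0,1] with ẋ(t) = f(x(t),y(t),u), ẏ(t) = g(x(t),y(t),u), ż(t) = max(g(x(t),y(t),u),0)·(1 − v·𝟙_{ℝ₊}(z(t)−y(t))). Then there exists Π* = (x*,y*,z*) ∈ S_ℓ minimizing z(T) over S_ℓ; moreover, every minimizer Π* satisfies z*(T) = sup_{t∈[0,T]} y*(t), and (x*,y*) is a solution of ẋ = f(x,y,u(t)), ẏ = g(x,y,u(t)) for some measurable control u : [0,T] → U that minimizes sup_{t∈[0,T]} y(t)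 over all measurable controls. -/
open MeasureTheory Set

/-- The set `S_ℓ` of absolutely continuous solutions `Π = (x,y,z)` of the
differential inclusion
`Π̇ ∈ F(Π) = ∪_{(u,v) ∈ U×[0,1]} (f(x,y,u), g(x,y,u), max(g(x,y,u),0)(1 - v·𝟙_{ℝ₊}(z-y)))`
with `Π(0) = (x₀,y₀,y₀)`, encoded in integral form: there are integrable a.e.
derivatives `(Fx,Fy,Fz)` selected a.e. from the right-hand side. -/
def solSetP3 (n p : ℕ) (T : ℝ) (U : Set (EuclideanSpace ℝ (Fin p)))
    (f : EuclideanSpace ℝ (Fin n) × ℝ × EuclideanSpace ℝ (Fin p) → EuclideanSpace ℝ (Fin n))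
    (g : EuclideanSpace ℝ (Fin n) × ℝ × EuclideanSpace ℝ (Fin p) → ℝ)
    (x₀ : EuclideanSpace ℝ (Fin n)) (y₀ : ℝ) :
    Set ((ℝ → EuclideanSpace ℝ (Fin n)) × (ℝ → ℝ) × (ℝ → ℝ)) :=
  {P | ∃ (Fx : ℝ → EuclideanSpace ℝ (Fin n)) (Fy Fz : ℝ → ℝ),
    IntegrableOn Fx (Icc 0 T) ∧ IntegrableOn Fy (Icc 0 T) ∧ IntegrableOn Fz (Icc 0 T) ∧
    P.1 0 = x₀ ∧ P.2.1 0 = y₀ ∧ P.2.2 0 = y₀ ∧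
    (∀ t ∈ Icc 0 T, P.1 t = x₀ + ∫ s in (0:ℝ)..t, Fx s) ∧
    (∀ t ∈ Icc 0 T, P.2.1 t = y₀ + ∫ s in (0:ℝ)..t, Fy s) ∧
    (∀ t ∈ Icc 0 T, P.2.2 t = y₀ + ∫ s in (0:ℝ)..t, Fz s) ∧
    (∀ᵐ t ∂(volume.restrict (Icc 0 T)), ∃ u ∈ U, ∃ v ∈ Icc (0:ℝ) 1,
      Fx t = f (P.1 t, P.2.1 t, u) ∧ Fy t = g (P.1 t, P.2.1 t, u) ∧
      Fz t = max (g (P.1 t, P.2.1 t, u)) 0 *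
        (1 - v * (if 0 ≤ P.2.2 t - P.2.1 t then (1:ℝ) else 0)))}

section

open Filter Topology NNReal

theorem exists_measurable_selection_of_isClosed {Ω X : Type*} [MeasurableSpace Ω] [MetricSpace X]
    [CompactSpace X] [MeasurableSpace X] [BorelSpace X] (A : Ω → Set X)
    (hne : ∀ ω, (A ω).Nonempty) (hcl : ∀ ω, IsClosed (A ω))
    (hm : ∀ K, IsClosed K → MeasurableSet {ω | (A ω ∩ K).Nonempty}) :
    ∃ u : Ω → X, Measurable u ∧ ∀ ω, u ω ∈ A ω := by
  rcases isEmpty_or_nonempty Ω with hΩ | ⟨⟨ω₀⟩⟩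
  · exact ⟨isEmptyElim, measurable_of_empty _, isEmptyElim⟩
  have : Nonempty X := ⟨(hne ω₀).some⟩
  let e := TopologicalSpace.denseSeq X
  let Good : (Ω → Set X) → Prop := fun B => (∀ ω, (B ω).Nonempty) ∧ (∀ ω, IsClosed (B ω)) ∧
    ∀ K, IsClosed K → MeasurableSet {ω | (B ω ∩ K).Nonempty}
  have step : ∀ (B : {B // Good B}) (n : ℕ), ∃ (B' : {B // Good B}) (i : Ω → ℕ),
      Measurable i ∧ ∀ ω, B'.1 ω = B.1 ω ∩ Metric.closedBall (e (i ω)) (1 / ((n : ℝ) + 1)) := by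
    rintro ⟨B, hB1, hB2, hB3⟩ n
    have hr : (0 : ℝ) < 1 / ((n : ℝ) + 1) := Nat.one_div_pos_of_nat
    have hex : ∀ ω, ∃ i, (B ω ∩ Metric.closedBall (e i) (1 / ((n : ℝ) + 1))).Nonempty := by
      intro ω
      obtain ⟨x, hx⟩ := hB1 ω
      obtain ⟨i, hi⟩ := (TopologicalSpace.denseRange_denseSeq X).exists_dist_lt x hr
      exact ⟨i, x, hx, hi.le⟩
    classical
    let i : Ω → ℕ := fun ω => Nat.find (hex ω)
    have hi : Measurable i :=
      measurable_find hex fun k => hB3 _ Metric.isClosed_closedBall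
    refine ⟨⟨fun ω => B ω ∩ Metric.closedBall (e (i ω)) (1 / ((n : ℝ) + 1)),
      fun ω => Nat.find_spec (hex ω), fun ω => (hB2 ω).inter Metric.isClosed_closedBall, ?_⟩,
      i, hi, fun ω => rfl⟩
    intro K hK
    have : {ω | (B ω ∩ Metric.closedBall (e (i ω)) (1 / ((n : ℝ) + 1)) ∩ K).Nonempty} =
        ⋃ j, ({ω | i ω = j} ∩
          {ω | (B ω ∩ (Metric.closedBall (e j) (1 / ((n : ℝ) + 1)) ∩ K)).Nonempty}) := by
      ext ω
      simp [inter_assoc]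
    rw [this]
    exact MeasurableSet.iUnion fun j => (hi (measurableSet_singleton j)).inter
      (hB3 _ (Metric.isClosed_closedBall.inter hK))
  choose next idx hidx hnext using step
  let B : ℕ → {B // Good B} := fun n => Nat.rec ⟨A, hne, hcl, hm⟩ (fun n b => next b n) n
  have hB : ∀ n ω, (B (n + 1)).1 ω =
      (B n).1 ω ∩ Metric.closedBall (e (idx (B n) n ω)) (1 / ((n : ℝ) + 1)) :=
    fun n ω => hnext (B n) n ω
  have hinter : ∀ ω, (⋂ n, (B n).1 ω).Nonempty := by
    intro ω
    apply IsCompact.nonempty_iInter_of_sequence_nonempty_isCompact_isClosed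
    · intro n
      rw [hB]
      exact inter_subset_left
    · exact fun n => (B n).2.1 ω
    · exact ((B 0).2.2.1 ω).isCompact
    · exact fun n => (B n).2.2.1 ω
  choose u hu using hinter
  simp only [mem_iInter] at hu
  refine ⟨u, ?_, fun ω => hu ω 0⟩
  refine measurable_of_tendsto_metrizable (f := fun n ω => e (idx (B n) n ω))
    (fun n => measurable_from_nat.comp (hidx (B n) n)) ?_
  rw [tendsto_pi_nhds]
  intro ω
  rw [tendsto_iff_dist_tendsto_zero]
  refine squeeze_zero (fun _ => dist_nonneg) (fun n => ?_) tendsto_one_div_add_atTop_nhds_zero_nat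
  have := hu ω (n + 1)
  rw [hB] at this
  rw [dist_comm]
  exact this.2

theorem exists_measurable_zero_of_caratheodory {Ω X : Type*} [MeasurableSpace Ω] [MetricSpace X]
    [CompactSpace X] [MeasurableSpace X] [BorelSpace X] (d : Ω → X → ℝ)
    (hd0 : ∀ ω x, 0 ≤ d ω x) (hdm : ∀ x, Measurable fun ω => d ω x)
    (hdc : ∀ ω, Continuous (d ω)) (hex : ∀ ω, ∃ x, d ω x = 0) :
    ∃ u : Ω → X, Measurable u ∧ ∀ ω, d ω (u ω) = 0 := by
  refine exists_measurable_selection_of_isClosed (fun ω => {x | d ω x = 0}) hex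
    (fun ω => isClosed_singleton.preimage (hdc ω)) fun K hK => ?_
  rcases K.eq_empty_or_nonempty with rfl | hKne
  · simp
  have : Nonempty K := hKne.to_subtype
  let e := TopologicalSpace.denseSeq K
  have : {ω | ({x | d ω x = 0} ∩ K).Nonempty} =
      ⋂ n : ℕ, ⋃ i, {ω | d ω (e i) < 1 / ((n : ℝ) + 1)} := by
    ext ω
    simp only [mem_iInter, mem_iUnion, mem_ofPred_eq]
    constructor
    · rintro ⟨x, hx, hxK⟩ n
      have hopen : IsOpen {k : K | d ω k < 1 / ((n : ℝ) + 1)} :=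
        isOpen_lt ((hdc ω).comp continuous_subtype_val) continuous_const
      obtain ⟨i, hi⟩ := (TopologicalSpace.denseRange_denseSeq K).exists_mem_open hopen
        ⟨⟨x, hxK⟩, by
          simp only [mem_ofPred_eq] at hx ⊢
          rw [hx]; exact Nat.one_div_pos_of_nat⟩
      exact ⟨i, hi⟩
    · intro h
      obtain ⟨x, hxK, hx⟩ := hK.isCompact.exists_isMinOn hKne (hdc ω).continuousOn
      refine ⟨x, le_antisymm ?_ (hd0 ω x), hxK⟩
      refine ge_of_tendsto' (tendsto_one_div_add_atTop_nhds_zero_nat (𝕜 := ℝ)) fun n => ?_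
      obtain ⟨i, hi⟩ := h n
      exact (hx (e i).2).trans hi.le
  rw [this]
  exact MeasurableSet.iInter fun n => MeasurableSet.iUnion fun i =>
    measurableSet_lt (hdm _) measurable_const

theorem LipschitzWith.intervalIntegrable_deriv {V : Type*} [NormedAddCommGroup V]
    [NormedSpace ℝ V] [FiniteDimensional ℝ V] {K : ℝ≥0} {w : ℝ → V} (hw : LipschitzWith K w)
    (a b : ℝ) : IntervalIntegrable (deriv w) volume a b := by
  have : CompleteSpace V := FiniteDimensional.complete ℝ V
  rw [intervalIntegrable_iff]
  exact Measure.integrableOn_of_bounded (by simp) (aestronglyMeasurable_deriv _ _)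
    (M := K) (ae_of_all _ fun x => norm_deriv_le_of_lipschitz hw)

theorem LipschitzWith.integral_deriv_eq_sub {V : Type*} [NormedAddCommGroup V]
    [NormedSpace ℝ V] [FiniteDimensional ℝ V] {K : ℝ≥0} {w : ℝ → V} (hw : LipschitzWith K w)
    (a b : ℝ) : ∫ t in a..b, deriv w t = w b - w a := by
  have : CompleteSpace V := FiniteDimensional.complete ℝ V
  have hI := fun c => hw.intervalIntegrable_deriv a c
  have hint : LipschitzWith K fun x => ∫ t in a..x, deriv w t := by
    refine LipschitzWith.of_dist_le_mul fun x y => ?_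
    rw [dist_eq_norm, intervalIntegral.integral_interval_sub_left (hI x) (hI y), Real.dist_eq]
    exact intervalIntegral.norm_integral_le_of_norm_le_const
      fun t _ => norm_deriv_le_of_lipschitz hw
  have hg : AbsolutelyContinuousOnInterval (fun x => w x - ∫ t in a..x, deriv w t) a b :=
    hw.lipschitzOnWith.absolutelyContinuousOnInterval.sub
      hint.lipschitzOnWith.absolutelyContinuousOnInterval
  obtain ⟨c, hc⟩ := hg.const_of_ae_hasDerivAt_zero (by
    filter_upwards [hw.ae_differentiableAt_real, (hI b).ae_hasDerivAt_integral] with x h1 h2 hx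
    have h3 := h1.hasDerivAt.sub (h2 hx a left_mem_uIcc)
    rw [sub_self] at h3
    exact h3)
  have h1 := hc a left_mem_uIcc
  have h2 := hc b right_mem_uIcc
  simp only [intervalIntegral.integral_same, sub_zero] at h1 h2
  rw [← h1] at h2
  rw [← h2]; abel

/-- `w` is an absolutely continuous solution on `[0, T]` of the differential inclusion `ẇ ∈ G w`
with `w 0 = w₀`, and `F` is its almost everywhere derivative. -/
structure IsTrajectory {V : Type*} [NormedAddCommGroup V] [NormedSpace ℝ V] (G : V → Set V)
    (T : ℝ) (w₀ : V) (w F : ℝ → V) : Prop where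
  integrableOn : IntegrableOn F (Icc 0 T)
  eq_add_integral : ∀ t ∈ Icc 0 T, w t = w₀ + ∫ s in (0 : ℝ)..t, F s
  deriv_mem : ∀ᵐ t ∂volume.restrict (Icc 0 T), F t ∈ G (w t)

namespace IsTrajectory

variable {V : Type*} [NormedAddCommGroup V] [NormedSpace ℝ V] {G : V → Set V} {T C : ℝ} {w₀ : V}
  {w F : ℝ → V}

theorem intervalIntegrable (h : IsTrajectory G T w₀ w F) {s t : ℝ} (hs : s ∈ Icc 0 T)
    (ht : t ∈ Icc 0 T) : IntervalIntegrable F volume s t := by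
  rw [intervalIntegrable_iff]
  exact h.integrableOn.mono_set (uIoc_subset_uIcc.trans (uIcc_subset_Icc hs ht))

theorem sub_eq_integral (h : IsTrajectory G T w₀ w F) {s t : ℝ} (hs : s ∈ Icc 0 T)
    (ht : t ∈ Icc 0 T) : w t - w s = ∫ r in s..t, F r := by
  have h0 : (0 : ℝ) ∈ Icc 0 T := ⟨le_rfl, hs.1.trans hs.2⟩
  rw [h.eq_add_integral t ht, h.eq_add_integral s hs, add_sub_add_left_eq_sub,
    intervalIntegral.integral_interval_sub_left (h.intervalIntegrable h0 ht)
      (h.intervalIntegrable h0 hs)]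

theorem continuousOn (hT : 0 ≤ T) (h : IsTrajectory G T w₀ w F) : ContinuousOn w (Icc 0 T) := by
  have h1 := h.integrableOn
  rw [← uIcc_of_le hT] at h1 ⊢
  refine (ContinuousOn.add (continuousOn_const (c := w₀))
    (intervalIntegral.continuousOn_primitive_interval h1)).congr fun t ht => ?_
  rw [uIcc_of_le hT] at ht
  exact h.eq_add_integral t ht

theorem norm_le (hT : 0 ≤ T) (hC : 0 ≤ C) (hG : ∀ w, ∀ v ∈ G w, ‖v‖ ≤ C * (1 + ‖w‖))
    (h : IsTrajectory G T w₀ w F) : ∀ t ∈ Icc 0 T, ‖w t‖ ≤ gronwallBound ‖w₀‖ C C T := by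
  let W : ℝ → V := IccExtend hT ((Icc 0 T).domRestrict w)
  have hW : Continuous W := (h.continuousOn hT).domRestrict.Icc_extend'
  have hWw : ∀ t ∈ Icc 0 T, W t = w t := fun t ht => IccExtend_of_mem hT _ ht
  have hcont : Continuous fun s => C * (1 + ‖W s‖) := by fun_prop
  let ψ : ℝ → ℝ := fun t => ‖w₀‖ + ∫ s in (0 : ℝ)..t, C * (1 + ‖W s‖)
  have hψ : ∀ t, HasDerivAt ψ (C * (1 + ‖W t‖)) t := fun t =>
    (hcont.integral_hasStrictDerivAt 0 t).hasDerivAt.const_add _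
  have hle : ∀ t ∈ Icc 0 T, ‖W t‖ ≤ ψ t := by
    intro t ht
    rw [hWw t ht, h.eq_add_integral t ht]
    refine (norm_add_le _ _).trans (add_le_add_right ?_ _)
    refine intervalIntegral.norm_integral_le_of_norm_le ht.1 ?_ (hcont.intervalIntegrable _ _)
    have h1 := h.deriv_mem
    rw [ae_restrict_iff' measurableSet_Icc] at h1
    filter_upwards [h1] with s hs hst
    have hs' : s ∈ Icc 0 T := ⟨hst.1.le, hst.2.trans ht.2⟩
    rw [hWw s hs']
    exact hG _ _ (hs hs')
  have hψ0 : ∀ t ∈ Icc 0 T, 0 ≤ ψ t := fun t ht => (norm_nonneg _).trans (hle t ht)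
  intro t ht
  have key := norm_le_gronwallBound_of_norm_deriv_right_le (f := ψ) (δ := ‖w₀‖) (K := C) (ε := C)
    (a := 0) (b := T) (fun t _ => (hψ t).continuousAt.continuousWithinAt)
    (fun t _ => (hψ t).hasDerivWithinAt) (by simp [ψ]) (fun t ht => by
      have ht' := Ico_subset_Icc_self ht
      rw [Real.norm_of_nonneg (by positivity), Real.norm_of_nonneg (hψ0 t ht')]
      nlinarith [hle t ht']) t ht
  rw [Real.norm_of_nonneg (hψ0 t ht), sub_zero] at key
  rw [← hWw t ht]
  exact (hle t ht).trans (key.trans (gronwallBound_mono (norm_nonneg _) hC hC ht.2))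

theorem ae_norm_deriv_le (hT : 0 ≤ T) (hC : 0 ≤ C) (hG : ∀ w, ∀ v ∈ G w, ‖v‖ ≤ C * (1 + ‖w‖))
    (h : IsTrajectory G T w₀ w F) :
    ∀ᵐ t, t ∈ Icc 0 T → ‖F t‖ ≤ C * (1 + gronwallBound ‖w₀‖ C C T) := by
  have h1 := h.deriv_mem
  rw [ae_restrict_iff' measurableSet_Icc] at h1
  filter_upwards [h1] with t ht htT
  refine (hG _ _ (ht htT)).trans ?_
  gcongr
  exact h.norm_le hT hC hG t htT

theorem exists_lipschitzWith_extension (hT : 0 ≤ T) (hC : 0 ≤ C) (M : ℝ≥0)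
    (hM : C * (1 + gronwallBound ‖w₀‖ C C T) ≤ M)
    (hG : ∀ w, ∀ v ∈ G w, ‖v‖ ≤ C * (1 + ‖w‖)) (h : IsTrajectory G T w₀ w F) :
    ∃ W : ℝ → V, LipschitzWith M W ∧ ∀ t ∈ Icc 0 T, W t = w t := by
  have hlip : LipschitzOnWith M w (Icc 0 T) := by
    refine LipschitzOnWith.of_dist_le_mul fun t ht s hs => ?_
    rw [dist_eq_norm, h.sub_eq_integral hs ht, Real.dist_eq]
    refine intervalIntegral.norm_integral_le_of_norm_le_const_ae ?_
    filter_upwards [h.ae_norm_deriv_le hT hC hG] with r hr hrt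
    exact (hr (uIcc_subset_Icc hs ht (uIoc_subset_uIcc hrt))).trans hM
  refine ⟨IccExtend hT ((Icc 0 T).domRestrict w), ?_, fun t ht => IccExtend_of_mem hT _ ht⟩
  have := hlip.to_restrict.comp (LipschitzWith.projIcc hT)
  rwa [mul_one] at this

theorem mono {G' : V → Set V} (h : IsTrajectory G T w₀ w F)
    (hG : ∀ t ∈ Icc 0 T, G (w t) ⊆ G' (w t)) : IsTrajectory G' T w₀ w F := by
  refine ⟨h.integrableOn, h.eq_add_integral, ?_⟩
  filter_upwards [h.deriv_mem, ae_restrict_mem measurableSet_Icc] with t ht htT using hG t htT ht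

end IsTrajectory

/-- Global existence for a continuously differentiable vector field of linear growth. -/
theorem exists_isTrajectory_singleton {V : Type*} [NormedAddCommGroup V] [NormedSpace ℝ V]
    [FiniteDimensional ℝ V] {T C : ℝ} (hT : 0 ≤ T) (hC : 0 ≤ C) {H : V → V}
    (hH : ContDiff ℝ 1 H) (hgrowth : ∀ w, ‖H w‖ ≤ C * (1 + ‖w‖)) (w₀ : V) :
    ∃ w F, IsTrajectory (fun w => {H w}) T w₀ w F := by
  have : CompleteSpace V := FiniteDimensional.complete ℝ V
  let R := gronwallBound ‖w₀‖ C C T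
  have hR : 0 ≤ R := (norm_nonneg w₀).trans <| by
    simpa only [gronwallBound_x0] using gronwallBound_mono (norm_nonneg w₀) hC hC hT
  let φ : ContDiffBump (0 : V) := ⟨R + 1, R + 2, by linarith, by linarith⟩
  let H' : V → V := fun w => φ w • H w
  have hH' : ContDiff ℝ 1 H' := φ.contDiff.smul hH
  have hsupp : HasCompactSupport H' := φ.hasCompactSupport.smul_right
  obtain ⟨K, hK⟩ := hH'.lipschitzWith_of_hasCompactSupport hsupp one_ne_zero
  obtain ⟨L, hL⟩ := hH'.continuous.bounded_above_of_compact_support hsupp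
  let L' : ℝ≥0 := ⟨max L 0, le_max_right _ _⟩
  have hpl : IsPicardLindelof (fun _ => H') (⟨0, le_rfl, hT⟩ : Icc 0 T) w₀
      (L' * ⟨T, hT⟩) 0 L' K :=
    IsPicardLindelof.of_time_independent (fun x _ => (hL x).trans (le_max_left _ _))
      hK.lipschitzOnWith (by simp only [sub_zero, sub_self, max_eq_left hT, NNReal.coe_zero]; rfl)
  obtain ⟨w, hw0, hw⟩ := hpl.exists_eq_forall_mem_Icc_hasDerivWithinAt₀
  simp only at hw0
  have hwc : ContinuousOn w (Icc 0 T) := fun t ht => (hw t ht).continuousWithinAt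
  have hFc : ContinuousOn (fun t => H' (w t)) (Icc 0 T) :=
    hH'.continuous.comp_continuousOn hwc
  have htraj : IsTrajectory (fun w => {H' w}) T w₀ w (fun t => H' (w t)) := by
    refine ⟨hFc.integrableOn_Icc, fun t ht => ?_, ae_of_all _ fun t => rfl⟩
    have hsub : Icc 0 t ⊆ Icc 0 T := Icc_subset_Icc_right ht.2
    rw [intervalIntegral.integral_eq_sub_of_hasDeriv_right_of_le ht.1 (hwc.mono hsub)
      (fun s hs => ?_) ((hFc.mono hsub).intervalIntegrable_of_Icc ht.1), hw0]
    · abel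
    · refine ((hw s (hsub (Ioo_subset_Icc_self hs))).hasDerivAt ?_).hasDerivWithinAt
      exact Icc_mem_nhds hs.1 (hs.2.trans_le ht.2)
  have hbound := htraj.norm_le hT hC (by
    rintro w v rfl
    refine le_trans ?_ (hgrowth w)
    rw [norm_smul, Real.norm_of_nonneg φ.nonneg]
    exact mul_le_of_le_one_left (norm_nonneg _) φ.le_one)
  refine ⟨w, _, htraj.mono fun t ht => ?_⟩
  have h1 : φ (w t) = 1 := φ.one_of_mem_closedBall (by
    rw [mem_closedBall_zero_iff]
    exact (hbound t ht).trans (by simp [φ, R]))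
  simp [H', h1]

/-- Sequential closedness of the solution set of a differential inclusion with compact convex
velocity sets. -/
theorem exists_isTrajectory_tendsto_hyperfilter {V P : Type*} [NormedAddCommGroup V]
    [NormedSpace ℝ V] [FiniteDimensional ℝ V] [TopologicalSpace P] {T C : ℝ} (hT : 0 ≤ T)
    (hC : 0 ≤ C) {h : V × P → V} (hh : Continuous h) {U : Set P} (hU : IsCompact U)
    (hconv : ∀ w, Convex ℝ ((fun u => h (w, u)) '' U))
    (hgrowth : ∀ w, ∀ u ∈ U, ‖h (w, u)‖ ≤ C * (1 + ‖w‖)) {w₀ : V} {w F : ℕ → ℝ → V}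
    (hw : ∀ k, IsTrajectory (fun w => (fun u => h (w, u)) '' U) T w₀ (w k) (F k)) :
    ∃ w' F', IsTrajectory (fun w => (fun u => h (w, u)) '' U) T w₀ w' F' ∧
      ∀ t ∈ Icc 0 T, Tendsto (fun k => w k t) (hyperfilter ℕ) (𝓝 (w' t)) := by
  have : CompleteSpace V := FiniteDimensional.complete ℝ V
  have : ProperSpace V := FiniteDimensional.proper ℝ V
  have hG : ∀ w, ∀ v ∈ (fun u => h (w, u)) '' U, ‖v‖ ≤ C * (1 + ‖w‖) := by
    rintro w _ ⟨u, hu, rfl⟩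
    exact hgrowth w u hu
  obtain ⟨M, hM⟩ : ∃ M : ℝ≥0, C * (1 + gronwallBound ‖w₀‖ C C T) ≤ M :=
    ⟨_, Real.le_coe_toNNReal _⟩
  have hcmp : ∀ t, ∃ l, t ∈ Icc 0 T → Tendsto (fun k => w k t) (hyperfilter ℕ) (𝓝 l) := by
    intro t
    by_cases ht : t ∈ Icc 0 T
    · obtain ⟨l, -, hl⟩ := (isCompact_closedBall (0 : V)
        (gronwallBound ‖w₀‖ C C T)).ultrafilter_le_nhds' ((hyperfilter ℕ).map fun k => w k t)
        (Ultrafilter.mem_map.2 (univ_mem' fun k =>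
          mem_closedBall_zero_iff.2 ((hw k).norm_le hT hC hG t ht)))
      exact ⟨l, fun _ => hl⟩
    · exact ⟨0, fun h => absurd h ht⟩
  choose w1 hw1 using hcmp
  have hlipk : ∀ k, ∀ s ∈ Icc 0 T, ∀ t ∈ Icc 0 T, dist (w k s) (w k t) ≤ M * dist s t := by
    intro k s hs t ht
    obtain ⟨W, hW, hWw⟩ := (hw k).exists_lipschitzWith_extension hT hC M hM hG
    rw [← hWw s hs, ← hWw t ht]
    exact hW.dist_le_mul s t
  have hlip1 : LipschitzOnWith M w1 (Icc 0 T) := by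
    refine LipschitzOnWith.of_dist_le_mul fun s hs t ht => ?_
    exact le_of_tendsto' ((hw1 s hs).dist (hw1 t ht)) fun k => hlipk k s hs t ht
  let w' := IccExtend hT ((Icc 0 T).domRestrict w1)
  have hlip : LipschitzWith M w' := by
    have := hlip1.to_restrict.comp (LipschitzWith.projIcc hT)
    rwa [mul_one] at this
  have hlim : ∀ t ∈ Icc 0 T, Tendsto (fun k => w k t) (hyperfilter ℕ) (𝓝 (w' t)) := by
    intro t ht
    rw [show w' t = w1 t from IccExtend_of_mem hT _ ht]
    exact hw1 t ht
  have h0 : w' 0 = w₀ := by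
    refine tendsto_nhds_unique (hlim 0 ⟨le_rfl, hT⟩) (tendsto_const_nhds.congr fun k => ?_)
    simpa using ((hw k).eq_add_integral 0 ⟨le_rfl, hT⟩).symm
  refine ⟨w', deriv w', ⟨?_, fun t _ => ?_, ?_⟩, hlim⟩
  · rw [integrableOn_Icc_iff_integrableOn_Ioc, ← intervalIntegrable_iff_integrableOn_Ioc_of_le hT]
    exact hlip.intervalIntegrable_deriv 0 T
  · rw [hlip.integral_deriv_eq_sub, h0]; abel
  rw [← Measure.restrict_congr_set (Ioo_ae_eq_Icc (μ := volume) (a := (0 : ℝ)) (b := T)),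
    ae_restrict_iff' measurableSet_Ioo]
  filter_upwards [hlip.ae_differentiableAt_real] with t htd ht
  have htT := Ioo_subset_Icc_self ht
  have hclosed : IsClosed ((fun u => h (w' t, u)) '' U) :=
    (hU.image (by fun_prop)).isClosed
  rw [← hclosed.closure_eq, Metric.closure_eq_iInter_cthickening]
  simp only [mem_iInter]
  intro ε hε
  set K := Metric.cthickening ε ((fun u => h (w' t, u)) '' U) with hK
  have hKc : IsClosed K := Metric.isClosed_cthickening
  have htube : ∀ᶠ z in 𝓝 (w' t), ∀ u ∈ U, h (z, u) ∈ K := by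
    have : ∀ᶠ z in 𝓝 (w' t), ∀ u ∈ U, dist (h (z, u)) (h (w' t, u)) < ε := by
      refine hU.eventually_forall_of_forall_eventually fun u _ => ?_
      have hc : Continuous fun z : V × P => dist (h (z.1, z.2)) (h (w' t, z.2)) := by fun_prop
      exact hc.continuousAt.eventually_lt continuousAt_const (by simpa using hε)
    filter_upwards [this] with z hz u hu
    exact Metric.mem_cthickening_of_dist_le _ _ ε _ (mem_image_of_mem _ hu) (hz u hu).le
  obtain ⟨δ, hδ, hball⟩ := Metric.eventually_nhds_iff.1 htube
  have hslope := (hasDerivAt_iff_tendsto_slope.1 htd.hasDerivAt).mono_left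
    (nhdsWithin_mono t (s := Ioi t) fun s hs => ne_of_gt hs)
  have hη : (0 : ℝ) < δ / (2 * (M + 1)) := by positivity
  refine hKc.mem_of_tendsto hslope ?_
  filter_upwards [Ioo_mem_nhdsGT (lt_min ht.2 (lt_add_of_pos_right t hη))] with s hs
  have hsT : s ∈ Icc 0 T := ⟨ht.1.le.trans hs.1.le, hs.2.le.trans (min_le_left _ _)⟩
  have hsη : s < t + δ / (2 * (M + 1)) := hs.2.trans_le (min_le_right _ _)
  refine hKc.mem_of_tendsto
    (f := fun k => slope (w k) t s) (((hlim s hsT).sub (hlim t htT)).const_smul ((s - t)⁻¹)) ?_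
  filter_upwards [Metric.tendsto_nhds.1 (hlim t htT) (δ / 2) (by positivity)] with k hk
  have hav : (⨍ r in t..s, F k r) ∈ K := by
    rw [uIoc_of_le hs.1.le]
    refine ((hconv (w' t)).cthickening ε).set_average_mem hKc (by simp [hs.1]) (by simp) ?_
      ((hw k).integrableOn.mono_set fun r hr => ⟨ht.1.le.trans hr.1.le, hr.2.trans hsT.2⟩)
    have h1 := (hw k).deriv_mem
    rw [ae_restrict_iff' measurableSet_Icc] at h1
    rw [ae_restrict_iff' measurableSet_Ioc]
    filter_upwards [h1] with r hr hrt
    have hrT : r ∈ Icc 0 T := ⟨ht.1.le.trans hrt.1.le, hrt.2.trans hsT.2⟩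
    obtain ⟨u, hu, hur⟩ := hr hrT
    rw [← hur]
    refine hball ?_ u hu
    have h2 := hlipk k r hrT t htT
    have h3 : (M : ℝ) * dist r t ≤ δ / 2 := by
      rw [Real.dist_eq, abs_of_pos (sub_pos.2 hrt.1)]
      have : r - t ≤ δ / (2 * (M + 1)) := by linarith [hrt.2]
      have hM0 : (0 : ℝ) ≤ M := M.2
      calc (M : ℝ) * (r - t) ≤ (M + 1) * (δ / (2 * (M + 1))) := by
            apply mul_le_mul _ this (sub_pos.2 hrt.1).le (by positivity)
            linarith
        _ = δ / 2 := by field_simp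
    linarith [dist_triangle (w k r) (w k t) (w' t)]
  rwa [interval_average_eq, ← (hw k).sub_eq_integral htT hsT] at hav

/-- A peak-minimizing trajectory exists as soon as there is a trajectory. -/
theorem exists_isTrajectory_minimizing_peak {V P : Type*} [NormedAddCommGroup V]
    [NormedSpace ℝ V] [FiniteDimensional ℝ V] [TopologicalSpace P] {T C : ℝ} (hT : 0 ≤ T)
    (hC : 0 ≤ C) {h : V × P → V} (hh : Continuous h) {U : Set P} (hU : IsCompact U)
    (hconv : ∀ w, Convex ℝ ((fun u => h (w, u)) '' U))
    (hgrowth : ∀ w, ∀ u ∈ U, ‖h (w, u)‖ ≤ C * (1 + ‖w‖)) {w₀ : V}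
    (hex : ∃ w F, IsTrajectory (fun w => (fun u => h (w, u)) '' U) T w₀ w F)
    {φ : V → ℝ} (hφ : Continuous φ) :
    ∃ w F, IsTrajectory (fun w => (fun u => h (w, u)) '' U) T w₀ w F ∧
      ∀ w' F' m, IsTrajectory (fun w => (fun u => h (w, u)) '' U) T w₀ w' F' →
        (∀ t ∈ Icc 0 T, φ (w' t) ≤ m) → ∀ t ∈ Icc 0 T, φ (w t) ≤ m := by
  let S : Set ℝ := {m | ∃ w F, IsTrajectory (fun w => (fun u => h (w, u)) '' U) T w₀ w F ∧
    ∀ t ∈ Icc 0 T, φ (w t) ≤ m}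
  have hSne : S.Nonempty := by
    obtain ⟨w, F, hw⟩ := hex
    obtain ⟨m, hm⟩ := (isCompact_Icc.image_of_continuousOn
      (hφ.comp_continuousOn (hw.continuousOn hT))).bddAbove
    exact ⟨m, w, F, hw, fun t ht => hm (mem_image_of_mem _ ht)⟩
  have hSbdd : BddBelow S := by
    refine ⟨φ w₀, ?_⟩
    rintro m ⟨w, F, hw, hm⟩
    have h0 : (0 : ℝ) ∈ Icc 0 T := ⟨le_rfl, hT⟩
    have := hm 0 h0
    rwa [hw.eq_add_integral 0 h0, intervalIntegral.integral_same, add_zero] at this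
  have hseq : ∀ k : ℕ, ∃ w F, IsTrajectory (fun w => (fun u => h (w, u)) '' U) T w₀ w F ∧
      ∀ t ∈ Icc 0 T, φ (w t) ≤ sInf S + 1 / ((k : ℝ) + 1) := by
    intro k
    obtain ⟨m, ⟨w, F, hw, hm⟩, hmlt⟩ := exists_lt_of_csInf_lt hSne
      (lt_add_of_pos_right (sInf S) (Nat.one_div_pos_of_nat (n := k)))
    exact ⟨w, F, hw, fun t ht => (hm t ht).trans hmlt.le⟩
  choose w F hw hwm using hseq
  obtain ⟨w', F', hw', hlim⟩ := exists_isTrajectory_tendsto_hyperfilter hT hC hh hU hconv hgrowth hw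
  refine ⟨w', F', hw', fun w₁ F₁ m hw₁ hm t ht =>
    le_trans ?_ (csInf_le hSbdd ⟨w₁, F₁, hw₁, hm⟩)⟩
  have h1 : Tendsto (fun k : ℕ => sInf S + 1 / ((k : ℝ) + 1)) (hyperfilter ℕ) (𝓝 (sInf S)) := by
    simpa using (tendsto_const_nhds.add
      (tendsto_one_div_add_atTop_nhds_zero_nat (𝕜 := ℝ))).mono_left Nat.hyperfilter_le_atTop
  exact le_of_tendsto_of_tendsto' ((hφ.tendsto _).comp (hlim t ht)) h1 fun k => hwm k t ht

/-- The Filippov lemma: a trajectory is driven by a measurable control. -/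
theorem IsTrajectory.exists_measurable_control {V P : Type*} [NormedAddCommGroup V]
    [NormedSpace ℝ V] [MetricSpace P] [MeasurableSpace P] [BorelSpace P] {T : ℝ}
    (hT : 0 ≤ T) {h : V × P → V} (hh : Continuous h) {U : Set P} (hU : IsCompact U)
    (hUne : U.Nonempty) {w₀ : V} {w F : ℝ → V}
    (hw : IsTrajectory (fun w => (fun u => h (w, u)) '' U) T w₀ w F) :
    ∃ u : ℝ → P, Measurable u ∧ (∀ t, u t ∈ U) ∧
      ∀ᵐ t ∂volume.restrict (Icc 0 T), F t = h (w t, u t) := by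
  have : CompactSpace U := isCompact_iff_compactSpace.1 hU
  let W : ℝ → V := IccExtend hT ((Icc 0 T).domRestrict w)
  have hW : Continuous W := (hw.continuousOn hT).domRestrict.Icc_extend'
  have hWw : ∀ t ∈ Icc 0 T, W t = w t := fun t ht => IccExtend_of_mem hT _ ht
  have hFm := hw.integrableOn.aestronglyMeasurable
  let F' := hFm.mk F
  have hgood : ∀ᵐ t ∂volume.restrict (Icc 0 T), F t = F' t ∧ W t = w t ∧
      ∃ u : U, F' t = h (W t, u) := by
    filter_upwards [hFm.ae_eq_mk, hw.deriv_mem, ae_restrict_mem measurableSet_Icc] with t h1 h2 h3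
    obtain ⟨u, hu, hut⟩ := h2
    refine ⟨h1, hWw t h3, ⟨u, hu⟩, ?_⟩
    rw [hWw t h3]
    exact h1.symm.trans hut.symm
  obtain ⟨N, hNsub, hNm, hN⟩ := exists_measurable_superset_of_null (ae_iff.1 hgood)
  have hgoodN : ∀ t ∉ N, F t = F' t ∧ W t = w t ∧ ∃ u : U, F' t = h (W t, u) := by
    intro t ht
    by_contra hcon
    exact ht (hNsub hcon)
  let d : ℝ → U → ℝ := fun t u => Nᶜ.indicator (fun t => ‖F' t - h (W t, u)‖) t
  obtain ⟨u, hum, hu⟩ := exists_measurable_zero_of_caratheodory d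
    (fun t u => indicator_nonneg (fun _ _ => norm_nonneg _) t)
    (fun u => by
      refine StronglyMeasurable.measurable (StronglyMeasurable.indicator ?_ hNm.compl)
      have hc : Continuous fun t => h (W t, u) := by fun_prop
      exact (hFm.stronglyMeasurable_mk.sub hc.stronglyMeasurable).norm)
    (fun t => by
      by_cases ht : t ∈ N
      · have : d t = fun _ => 0 := funext fun u => by simp [d, ht]
        rw [this]; exact continuous_const
      · have : d t = fun u : U => ‖F' t - h (W t, u)‖ := funext fun u => by simp [d, ht]
        rw [this]; fun_prop)
    (fun t => by
      by_cases ht : t ∈ N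
      · exact ⟨⟨_, hUne.some_mem⟩, by simp [d, ht]⟩
      · obtain ⟨-, -, u, hu⟩ := hgoodN t ht
        exact ⟨u, by simp [d, ht, hu]⟩)
  refine ⟨fun t => u t, measurable_subtype_coe.comp hum, fun t => (u t).2, ?_⟩
  have hNae : ∀ᵐ t ∂volume.restrict (Icc 0 T), t ∉ N := measure_eq_zero_iff_ae_notMem.1 hN
  filter_upwards [hNae] with t ht
  obtain ⟨h1, h2, -⟩ := hgoodN t ht
  have h3 := hu t
  simp only [d, indicator_of_mem (show t ∈ Nᶜ from ht), norm_eq_zero, sub_eq_zero] at h3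
  rw [h1, h3, h2]

theorem IsTrajectory.ae_hasDerivAt {V : Type*} [NormedAddCommGroup V] [NormedSpace ℝ V]
    [CompleteSpace V] {G : V → Set V} {T : ℝ} {w₀ : V} {w F : ℝ → V} (hT : 0 ≤ T)
    (hw : IsTrajectory G T w₀ w F) : ∀ᵐ t, t ∈ Ioo 0 T → HasDerivAt w (F t) t := by
  have h0 : (0 : ℝ) ∈ Icc 0 T := ⟨le_rfl, hT⟩
  filter_upwards [(hw.intervalIntegrable h0 ⟨hT, le_rfl⟩).ae_hasDerivAt_integral] with t ht htT
  rw [uIcc_of_le hT] at ht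
  refine ((ht (Ioo_subset_Icc_self htT) 0 h0).const_add w₀).congr_of_eventuallyEq ?_
  filter_upwards [Icc_mem_nhds htT.1 htT.2] with s hs using hw.eq_add_integral s hs

/-- The running maximum of a Lipschitz function. -/
theorem LipschitzWith.exists_running_max {M : ℝ≥0} {y : ℝ → ℝ} (hy : LipschitzWith M y) :
    ∃ z : ℝ → ℝ, LipschitzWith M z ∧ z 0 = y 0 ∧ (∀ t, y t ≤ z t) ∧
      (∀ t, 0 ≤ t → ∀ m, (∀ s ∈ Icc 0 t, y s ≤ m) → z t ≤ m) ∧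
      ∀ t, 0 < t → DifferentiableAt ℝ y t →
        deriv z t = 0 ∨ deriv z t = max (deriv y t) 0 := by
  let z : ℝ → ℝ := fun t => sSup ((fun θ => y (θ * t)) '' Icc 0 1)
  have hlub : ∀ t, IsLUB ((fun θ => y (θ * t)) '' Icc 0 1) (z t) := by
    intro t
    have hc : Continuous fun θ => y (θ * t) := hy.continuous.comp (by fun_prop)
    exact isLUB_csSup ((nonempty_Icc.2 zero_le_one).image _) (isCompact_Icc.image hc).bddAbove
  have hle : ∀ t, ∀ θ ∈ Icc (0 : ℝ) 1, y (θ * t) ≤ z t := fun t θ hθ =>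
    (hlub t).1 (mem_image_of_mem _ hθ)
  have hub : ∀ t m, (∀ θ ∈ Icc (0 : ℝ) 1, y (θ * t) ≤ m) → z t ≤ m := fun t m hm =>
    (hlub t).2 (forall_mem_image.2 hm)
  have hyz : ∀ t, y t ≤ z t := fun t => by simpa using hle t 1 (by simp)
  have hleIcc : ∀ t s, s ∈ Icc 0 t → y s ≤ z t := by
    intro t s hs
    rcases hs.1.eq_or_lt with rfl | hs0
    · simpa using hle t 0 (by simp)
    · have ht : 0 < t := hs0.trans_le hs.2
      have := hle t (s / t) ⟨by positivity, (div_le_one ht).2 hs.2⟩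
      rwa [div_mul_cancel₀ _ ht.ne'] at this
  have hubIcc : ∀ t, 0 ≤ t → ∀ m, (∀ s ∈ Icc 0 t, y s ≤ m) → z t ≤ m := by
    intro t ht m hm
    exact hub t m fun θ hθ => hm _ ⟨mul_nonneg hθ.1 ht, mul_le_of_le_one_left ht hθ.2⟩
  have hmono : ∀ s t, 0 ≤ s → s ≤ t → z s ≤ z t := fun s t hs hst =>
    hubIcc s hs _ fun r hr => hleIcc t r ⟨hr.1, hr.2.trans hst⟩
  refine ⟨z, ?_, ?_, hyz, hubIcc, ?_⟩
  · refine LipschitzWith.of_le_add_mul M fun s t => hub s _ fun θ hθ => ?_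
    have h1 := hle t θ hθ
    have h2 := (le_abs_self _).trans (hy.dist_le_mul (θ * s) (θ * t))
    have h3 : dist (θ * s) (θ * t) ≤ dist s t := by
      rw [Real.dist_eq, Real.dist_eq, ← mul_sub, abs_mul, abs_of_nonneg hθ.1]
      exact mul_le_of_le_one_left (abs_nonneg _) hθ.2
    have h4 := mul_le_mul_of_nonneg_left h3 M.2
    change (M : ℝ) * _ ≤ M * _ at h4
    linarith
  · exact le_antisymm (hubIcc 0 le_rfl _ fun s hs => by rw [le_antisymm hs.2 hs.1]) (hyz 0)
  intro t ht hyd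
  by_cases hzd : DifferentiableAt ℝ z t
  swap
  · exact .inl (deriv_zero_of_not_differentiableAt hzd)
  have hslope := (hasDerivAt_iff_tendsto_slope.1 hzd.hasDerivAt).mono_left
    (nhdsWithin_mono t (s := Ioi t) fun s hs => ne_of_gt hs)
  rcases (hyz t).eq_or_lt with heq | hlt
  · right
    have hmin : IsLocalMin (z - y) t := Eventually.of_forall fun s => by
      simp [heq, hyz s]
    have h1 := hmin.deriv_eq_zero
    rw [deriv_sub hzd hyd, sub_eq_zero] at h1
    have h2 : 0 ≤ deriv z t := by
      refine ge_of_tendsto hslope ?_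
      filter_upwards [self_mem_nhdsWithin] with s hs
      rw [slope_def_field]
      exact div_nonneg (sub_nonneg.2 (hmono t s ht.le (le_of_lt hs))) (sub_nonneg.2 (le_of_lt hs))
    rw [← h1, max_eq_left h2]
  · left
    obtain ⟨δ, hδ, hball⟩ := Metric.eventually_nhds_iff.1
      (hy.continuous.continuousAt.eventually_lt (continuousAt_const (y := z t)) hlt)
    refine tendsto_nhds_unique hslope (tendsto_const_nhds.congr' ?_)
    filter_upwards [Ioo_mem_nhdsGT (lt_add_of_pos_right t hδ)] with s hs
    have hzs : z s = z t := by
      refine le_antisymm (hubIcc s (ht.le.trans hs.1.le) _ fun r hr => ?_)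
        (hmono t s ht.le hs.1.le)
      rcases le_total r t with hrt | hrt
      · exact hleIcc t r ⟨hr.1, hrt⟩
      · refine (hball ?_).le
        rw [Real.dist_eq, abs_of_nonneg (sub_nonneg.2 hrt)]
        linarith [hr.2, hs.2]
    rw [slope_def_field, hzs, sub_self, zero_div]

/-- A nondecreasing function which grows at least as fast as `y` while it is below `y` stays above
`y`. -/
theorem IsTrajectory.le_of_ae_le {G G' : ℝ → Set ℝ} {T y₀ : ℝ} {y Fy z Fz : ℝ → ℝ}
    (hT : 0 ≤ T) (hy : IsTrajectory G T y₀ y Fy) (hz : IsTrajectory G' T y₀ z Fz)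
    (hnonneg : ∀ᵐ t ∂volume.restrict (Icc 0 T), 0 ≤ Fz t)
    (hle : ∀ᵐ t ∂volume.restrict (Icc 0 T), z t < y t → Fy t ≤ Fz t) :
    ∀ t ∈ Icc 0 T, y t ≤ z T := by
  have h0 : (0 : ℝ) ∈ Icc 0 T := ⟨le_rfl, hT⟩
  rw [ae_restrict_iff' measurableSet_Icc] at hnonneg hle
  intro t ht
  have hzT : z t ≤ z T := by
    rw [← sub_nonneg, hz.sub_eq_integral ht ⟨hT, le_rfl⟩]
    refine intervalIntegral.integral_nonneg_of_ae_restrict ht.2 ?_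
    rw [EventuallyLE, ae_restrict_iff' measurableSet_Icc]
    filter_upwards [hnonneg] with s hs hst using hs ⟨ht.1.trans hst.1, hst.2⟩
  refine le_trans ?_ hzT
  by_contra! hlt
  have hsub : Icc 0 t ⊆ Icc 0 T := Icc_subset_Icc_right ht.2
  have hScl : IsClosed {s ∈ Icc 0 t | y s ≤ z s} :=
    isClosed_Icc.isClosed_le ((hy.continuousOn hT).mono hsub) ((hz.continuousOn hT).mono hsub)
  have hS0 : (0 : ℝ) ∈ {s ∈ Icc 0 t | y s ≤ z s} := by
    refine ⟨⟨le_rfl, ht.1⟩, ?_⟩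
    rw [hy.eq_add_integral 0 h0, hz.eq_add_integral 0 h0]
    simp
  obtain ⟨s, ⟨hs, hys⟩, hmax⟩ :=
    (isCompact_Icc.of_isClosed_subset hScl fun s hs => hs.1).exists_isGreatest ⟨0, hS0⟩
  have hsT := hsub hs
  have hint : y t - y s ≤ z t - z s := by
    rw [hy.sub_eq_integral hsT ht, hz.sub_eq_integral hsT ht]
    refine intervalIntegral.integral_mono_ae_restrict hs.2 (hy.intervalIntegrable hsT ht)
      (hz.intervalIntegrable hsT ht) ?_
    rw [EventuallyLE, ae_restrict_iff' measurableSet_Icc]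
    filter_upwards [hle, Measure.ae_ne volume s] with r hr hrs hrt
    refine hr ⟨hsT.1.trans hrt.1, hrt.2.trans ht.2⟩ ?_
    by_contra! hcon
    exact hrs (le_antisymm (hmax ⟨⟨hs.1.trans hrt.1, hrt.2⟩, hcon⟩) hrt.1)
  linarith

/-- The control system `ẋ = f (x, y, u)`, `ẏ = g (x, y, u)` as a single vector field on the
product of the state spaces. -/
def jointField {E P : Type*} (f : E × ℝ × P → E) (g : E × ℝ × P → ℝ) (q : (E × ℝ) × P) : E × ℝ :=
  (f (q.1.1, q.1.2, q.2), g (q.1.1, q.1.2, q.2))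

section Product

variable {E E' : Type*} [NormedAddCommGroup E] [NormedSpace ℝ E] [NormedAddCommGroup E']
  [NormedSpace ℝ E'] {G : E × E' → Set (E × E')} {T : ℝ}

theorem intervalIntegral_prodMk [CompleteSpace E] [CompleteSpace E'] {a b : ℝ} {f : ℝ → E}
    {g : ℝ → E'} (hf : IntervalIntegrable f volume a b) (hg : IntervalIntegrable g volume a b) :
    ∫ t in a..b, (f t, g t) = (∫ t in a..b, f t, ∫ t in a..b, g t) := by
  simp only [intervalIntegral]
  rw [integral_pair hf.1 hg.1, integral_pair hf.2 hg.2, Prod.mk_sub_mk]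

theorem isTrajectory_prodMk [CompleteSpace E] [CompleteSpace E'] {x₀ : E} {y₀ : E'}
    {x Fx : ℝ → E} {y Fy : ℝ → E'} (hFx : IntegrableOn Fx (Icc 0 T))
    (hFy : IntegrableOn Fy (Icc 0 T)) (hx : ∀ t ∈ Icc 0 T, x t = x₀ + ∫ s in (0 : ℝ)..t, Fx s)
    (hy : ∀ t ∈ Icc 0 T, y t = y₀ + ∫ s in (0 : ℝ)..t, Fy s)
    (hmem : ∀ᵐ t ∂volume.restrict (Icc 0 T), (Fx t, Fy t) ∈ G (x t, y t)) :
    IsTrajectory G T (x₀, y₀) (fun t => (x t, y t)) fun t => (Fx t, Fy t) := by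
  refine ⟨hFx.prodMk hFy, fun t ht => ?_, hmem⟩
  have hsub : uIoc 0 t ⊆ Icc 0 T := by
    rw [uIoc_of_le ht.1]
    exact Ioc_subset_Icc_self.trans (Icc_subset_Icc_right ht.2)
  rw [intervalIntegral_prodMk (intervalIntegrable_iff.2 (hFx.mono_set hsub))
    (intervalIntegrable_iff.2 (hFy.mono_set hsub)), Prod.mk_add_mk, ← hx t ht, ← hy t ht]

theorem IsTrajectory.fst_snd_eq [CompleteSpace E] [CompleteSpace E'] {w₀ : E × E'}
    {w F : ℝ → E × E'} (hw : IsTrajectory G T w₀ w F) {t : ℝ} (ht : t ∈ Icc 0 T) :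
    (w t).1 = w₀.1 + ∫ s in (0 : ℝ)..t, (F s).1 ∧ (w t).2 = w₀.2 + ∫ s in (0 : ℝ)..t, (F s).2 := by
  have hi : IntervalIntegrable F volume 0 t :=
    hw.intervalIntegrable ⟨le_rfl, ht.1.trans ht.2⟩ ht
  have h := intervalIntegral_prodMk (f := fun s => (F s).1) (g := fun s => (F s).2)
    ⟨hi.1.fst, hi.2.fst⟩ ⟨hi.1.snd, hi.2.snd⟩
  have h1 := hw.eq_add_integral t ht
  simp only [Prod.mk.eta] at h
  rw [h] at h1
  exact ⟨congrArg Prod.fst h1, congrArg Prod.snd h1⟩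

end Product

section ControlSystem

variable {n p : ℕ} {T C : ℝ} {U : Set (EuclideanSpace ℝ (Fin p))}
  {f : EuclideanSpace ℝ (Fin n) × ℝ × EuclideanSpace ℝ (Fin p) → EuclideanSpace ℝ (Fin n)}
  {g : EuclideanSpace ℝ (Fin n) × ℝ × EuclideanSpace ℝ (Fin p) → ℝ}
  {x₀ : EuclideanSpace ℝ (Fin n)} {y₀ : ℝ}

theorem norm_jointField_le (hC : 0 ≤ C)
    (hgrowth : ∀ x y u, u ∈ U → ‖f (x, y, u)‖ + |g (x, y, u)| ≤ C * (1 + ‖x‖ + |y|))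
    (w : EuclideanSpace ℝ (Fin n) × ℝ) {u : EuclideanSpace ℝ (Fin p)} (hu : u ∈ U) :
    ‖jointField f g (w, u)‖ ≤ 2 * C * (1 + ‖w‖) := by
  have h1 : ‖w.1‖ ≤ ‖w‖ := norm_fst_le w
  have h2 : |w.2| ≤ ‖w‖ := norm_snd_le w
  have h3 : C * (1 + ‖w.1‖ + |w.2|) ≤ 2 * C * (1 + ‖w‖) := by nlinarith
  have h4 := (hgrowth w.1 w.2 u hu).trans h3
  refine max_le ?_ ?_
  · exact (le_add_of_nonneg_right (abs_nonneg _)).trans h4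
  · exact (le_add_of_nonneg_left (norm_nonneg _)).trans h4

theorem isTrajectory_of_mem_solSetP3
    {Q : (ℝ → EuclideanSpace ℝ (Fin n)) × (ℝ → ℝ) × (ℝ → ℝ)} (hT : 0 ≤ T)
    (hQ : Q ∈ solSetP3 n p T U f g x₀ y₀) :
    (∃ F, IsTrajectory (fun w => (fun u => jointField f g (w, u)) '' U) T (x₀, y₀)
      (fun t => (Q.1 t, Q.2.1 t)) F) ∧ ∀ t ∈ Icc 0 T, Q.2.1 t ≤ Q.2.2 T := by
  obtain ⟨Fx, Fy, Fz, hFx, hFy, hFz, -, -, -, hx, hy, hz, hmem⟩ := hQ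
  refine ⟨⟨fun t => (Fx t, Fy t), isTrajectory_prodMk hFx hFy hx hy ?_⟩, ?_⟩
  · filter_upwards [hmem] with t ⟨u, hu, v, _, h1, h2, _⟩
    exact ⟨u, hu, by simp [jointField, h1, h2]⟩
  · refine IsTrajectory.le_of_ae_le (G := fun _ => univ) (G' := fun _ => univ) hT
      ⟨hFy, hy, ae_of_all _ fun _ => mem_univ _⟩ ⟨hFz, hz, ae_of_all _ fun _ => mem_univ _⟩ ?_ ?_
    · filter_upwards [hmem] with t ⟨u, hu, v, hv, _, _, h3⟩
      rw [h3]
      refine mul_nonneg (le_max_right _ _) ?_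
      split_ifs <;> linarith [hv.2]
    · filter_upwards [hmem] with t ⟨u, hu, v, hv, _, h2, h3⟩ hlt
      rw [h2, h3, if_neg (by linarith)]
      simp

theorem IsTrajectory.exists_mem_solSetP3 (hT : 0 ≤ T) (hC : 0 ≤ C)
    (hgrowth : ∀ x y u, u ∈ U → ‖f (x, y, u)‖ + |g (x, y, u)| ≤ C * (1 + ‖x‖ + |y|))
    {w F : ℝ → EuclideanSpace ℝ (Fin n) × ℝ}
    (hw : IsTrajectory (fun w => (fun u => jointField f g (w, u)) '' U) T (x₀, y₀) w F) :
    ∃ z : ℝ → ℝ, (fun t => (w t).1, fun t => (w t).2, z) ∈ solSetP3 n p T U f g x₀ y₀ ∧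
      ∀ m, (∀ t ∈ Icc 0 T, (w t).2 ≤ m) → z T ≤ m := by
  have h0 : (0 : ℝ) ∈ Icc 0 T := ⟨le_rfl, hT⟩
  have hw0 : w 0 = (x₀, y₀) := by simpa using hw.eq_add_integral 0 h0
  obtain ⟨W, hW, hWw⟩ := hw.exists_lipschitzWith_extension hT (C := 2 * C) (by positivity) _
    (Real.le_coe_toNNReal _) (by
      rintro w _ ⟨u, hu, rfl⟩
      exact norm_jointField_le hC hgrowth w hu)
  have hy : LipschitzWith _ fun t => (W t).2 := LipschitzWith.prod_snd.comp hW
  obtain ⟨z, hz, hz0, hle, hmin, hderiv⟩ := hy.exists_running_max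
  have hz0' : z 0 = y₀ := by rw [hz0, hWw 0 h0, hw0]
  refine ⟨z, ⟨fun t => (F t).1, fun t => (F t).2, deriv z, hw.integrableOn.fst,
    hw.integrableOn.snd, ?_, congrArg Prod.fst hw0, congrArg Prod.snd hw0, hz0',
    fun t ht => (hw.fst_snd_eq ht).1, fun t ht => (hw.fst_snd_eq ht).2, fun t ht => ?_, ?_⟩,
    fun m hm => hmin T hT m fun s hs => ?_⟩
  · rw [integrableOn_Icc_iff_integrableOn_Ioc, ← intervalIntegrable_iff_integrableOn_Ioc_of_le hT]
    exact hz.intervalIntegrable_deriv 0 T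
  · rw [hz.integral_deriv_eq_sub, hz0', add_sub_cancel]
  · have hmem := hw.deriv_mem
    rw [← Measure.restrict_congr_set Ioo_ae_eq_Icc, ae_restrict_iff' measurableSet_Ioo] at hmem ⊢
    filter_upwards [hmem, hw.ae_hasDerivAt hT] with t h1 h2 ht
    obtain ⟨u, hu, hut⟩ := h1 ht
    have hFx : (F t).1 = f ((w t).1, (w t).2, u) := (congrArg Prod.fst hut).symm
    have hFy : (F t).2 = g ((w t).1, (w t).2, u) := (congrArg Prod.snd hut).symm
    have hWd : HasDerivAt (fun s => (W s).2) (F t).2 t := by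
      refine HasDerivAt.congr_of_eventuallyEq (f := fun s => (w s).2) (h2 ht).snd ?_
      filter_upwards [Icc_mem_nhds ht.1 ht.2] with s hs
      rw [hWw s hs]
    have hind : 0 ≤ z t - (w t).2 := by
      rw [← hWw t (Ioo_subset_Icc_self ht)]
      exact sub_nonneg.2 (hle t)
    rcases hderiv t ht.1 hWd.differentiableAt with h3 | h3
    · exact ⟨u, hu, 1, by simp, hFx, hFy, by simp [h3, hind]⟩
    · exact ⟨u, hu, 0, by simp, hFx, hFy, by simp [h3, hWd.deriv, hFy]⟩
  · rw [hWw s hs]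
    exact hm s hs

theorem isTrajectory_of_control (hf : Continuous f) (hg : Continuous g)
    (hgrowth : ∀ x y u, u ∈ U → ‖f (x, y, u)‖ + |g (x, y, u)| ≤ C * (1 + ‖x‖ + |y|))
    {u : ℝ → EuclideanSpace ℝ (Fin p)} {x : ℝ → EuclideanSpace ℝ (Fin n)} {y : ℝ → ℝ}
    (hu : Measurable u) (huU : ∀ t, u t ∈ U) (hxc : Continuous x) (hyc : Continuous y)
    (hx : ∀ t ∈ Icc 0 T, x t = x₀ + ∫ s in (0 : ℝ)..t, f (x s, y s, u s))
    (hy : ∀ t ∈ Icc 0 T, y t = y₀ + ∫ s in (0 : ℝ)..t, g (x s, y s, u s)) :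
    IsTrajectory (fun w => (fun u => jointField f g (w, u)) '' U) T (x₀, y₀)
      (fun t => (x t, y t)) fun t => (f (x t, y t, u t), g (x t, y t, u t)) := by
  have hm : Measurable fun t => (x t, y t, u t) :=
    hxc.measurable.prodMk (hyc.measurable.prodMk hu)
  have hb : IntegrableOn (fun t => C * (1 + ‖x t‖ + |y t|)) (Icc 0 T) :=
    (Continuous.continuousOn (by fun_prop)).integrableOn_Icc
  refine isTrajectory_prodMk ?_ ?_ hx hy (ae_of_all _ fun t => ⟨u t, huU t, rfl⟩)
  · refine hb.mono' (hf.measurable.comp hm).aestronglyMeasurable (ae_of_all _ fun t => ?_)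
    exact (le_add_of_nonneg_right (abs_nonneg _)).trans (hgrowth _ _ _ (huU t))
  · refine hb.mono' (hg.measurable.comp hm).aestronglyMeasurable (ae_of_all _ fun t => ?_)
    exact (le_add_of_nonneg_left (norm_nonneg _)).trans (hgrowth _ _ _ (huU t))

theorem exists_isTrajectory_jointField (hT : 0 ≤ T) (hC : 0 ≤ C) (hU : U.Nonempty)
    (hf : ContDiff ℝ 1 f) (hg : ContDiff ℝ 1 g)
    (hgrowth : ∀ x y u, u ∈ U → ‖f (x, y, u)‖ + |g (x, y, u)| ≤ C * (1 + ‖x‖ + |y|))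
    (w₀ : EuclideanSpace ℝ (Fin n) × ℝ) :
    ∃ w F, IsTrajectory (fun w => (fun u => jointField f g (w, u)) '' U) T w₀ w F := by
  obtain ⟨u, hu⟩ := hU
  have hH : ContDiff ℝ 1 fun w => jointField f g (w, u) := by
    unfold jointField
    fun_prop
  obtain ⟨w, F, hw⟩ := exists_isTrajectory_singleton hT (by positivity) hH
    (fun w => norm_jointField_le hC hgrowth w hu) w₀
  exact ⟨w, F, hw.mono fun t _ => singleton_subset_iff.2 ⟨u, hu, rfl⟩⟩

end ControlSystem

end

/-- Proposition 4 of the paper: under convexity of the velocity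
set, the Mayer problem `P₃ : inf_{Π ∈ S_ℓ} z(T)` admits a minimizer; every
minimizer `Π* = (x*,y*,z*)` satisfies `z*(T) = sup_{[0,T]} y*`, and `(x*,y*)`
solves `ẋ = f(x,y,u(t)), ẏ = g(x,y,u(t))` for some measurable control `u`
valued in `U` that minimizes the peak `sup_{[0,T]} y` over all measurable
controls. -/
theorem stmt7 (n p : ℕ) (T : ℝ) (hT : 0 < T)
    (U : Set (EuclideanSpace ℝ (Fin p))) (hUne : U.Nonempty) (hUcomp : IsCompact U)
    (f : EuclideanSpace ℝ (Fin n) × ℝ × EuclideanSpace ℝ (Fin p) → EuclideanSpace ℝ (Fin n))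
    (g : EuclideanSpace ℝ (Fin n) × ℝ × EuclideanSpace ℝ (Fin p) → ℝ)
    (hf : ContDiff ℝ 1 f) (hg : ContDiff ℝ 1 g)
    (C : ℝ) (hC : 0 < C)
    (hgrowth : ∀ x y u, u ∈ U → ‖f (x, y, u)‖ + |g (x, y, u)| ≤ C * (1 + ‖x‖ + |y|))
    (hconv : ∀ x y, Convex ℝ ((fun u => (f (x, y, u), g (x, y, u))) '' U))
    (x₀ : EuclideanSpace ℝ (Fin n)) (y₀ : ℝ) :
    (∃ P ∈ solSetP3 n p T U f g x₀ y₀,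
      ∀ Q ∈ solSetP3 n p T U f g x₀ y₀, P.2.2 T ≤ Q.2.2 T) ∧
    (∀ P ∈ solSetP3 n p T U f g x₀ y₀,
      (∀ Q ∈ solSetP3 n p T U f g x₀ y₀, P.2.2 T ≤ Q.2.2 T) →
      P.2.2 T = sSup (P.2.1 '' Icc 0 T) ∧
      ∃ u : ℝ → EuclideanSpace ℝ (Fin p), Measurable u ∧ (∀ t, u t ∈ U) ∧
        (∀ t ∈ Icc 0 T, P.1 t = x₀ + ∫ s in (0:ℝ)..t, f (P.1 s, P.2.1 s, u s)) ∧
        (∀ t ∈ Icc 0 T, P.2.1 t = y₀ + ∫ s in (0:ℝ)..t, g (P.1 s, P.2.1 s, u s)) ∧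
        (∀ (u' : ℝ → EuclideanSpace ℝ (Fin p)) (x' : ℝ → EuclideanSpace ℝ (Fin n))
            (y' : ℝ → ℝ),
          Measurable u' → (∀ t, u' t ∈ U) → Continuous x' → Continuous y' →
          (∀ t ∈ Icc 0 T, x' t = x₀ + ∫ s in (0:ℝ)..t, f (x' s, y' s, u' s)) →
          (∀ t ∈ Icc 0 T, y' t = y₀ + ∫ s in (0:ℝ)..t, g (x' s, y' s, u' s)) →
          sSup (P.2.1 '' Icc 0 T) ≤ sSup (y' '' Icc 0 T))) := by
  have hfc := hf.continuous
  have hgc := hg.continuous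
  have hh : Continuous (jointField f g) := by
    unfold jointField
    fun_prop
  have le_sSup_peak : ∀ y : ℝ → ℝ, ContinuousOn y (Icc 0 T) →
      ∀ t ∈ Icc 0 T, y t ≤ sSup (y '' Icc 0 T) := fun y hy t ht =>
    le_csSup (isCompact_Icc.image_of_continuousOn hy).bddAbove (mem_image_of_mem y ht)
  constructor
  · obtain ⟨w, F, hw, hmin⟩ := exists_isTrajectory_minimizing_peak hT.le
      (C := 2 * C) (by positivity) hh hUcomp (fun w => hconv w.1 w.2)
      (fun w u hu => norm_jointField_le hC.le hgrowth w hu)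
      (exists_isTrajectory_jointField hT.le hC.le hUne hf hg hgrowth (x₀, y₀)) continuous_snd
    obtain ⟨z, hz, hzle⟩ := hw.exists_mem_solSetP3 hT.le hC.le hgrowth
    refine ⟨_, hz, fun Q hQ => hzle _ ?_⟩
    obtain ⟨⟨F', hw'⟩, hQle⟩ := isTrajectory_of_mem_solSetP3 hT.le hQ
    exact hmin _ F' _ hw' hQle
  · intro P hP hPmin
    obtain ⟨⟨F, hw⟩, hPle⟩ := isTrajectory_of_mem_solSetP3 hT.le hP
    have hpeak : P.2.2 T = sSup (P.2.1 '' Icc 0 T) := by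
      refine le_antisymm ?_ (csSup_le ((nonempty_Icc.2 hT.le).image _) ?_)
      · obtain ⟨z, hz, hzle⟩ := hw.exists_mem_solSetP3 hT.le hC.le hgrowth
        exact (hPmin _ hz).trans (hzle _ (le_sSup_peak _ (hw.continuousOn hT.le).snd))
      · rintro _ ⟨t, ht, rfl⟩
        exact hPle t ht
    obtain ⟨u, hu, huU, hFu⟩ := hw.exists_measurable_control hT.le hh hUcomp hUne
    rw [ae_restrict_iff' measurableSet_Icc] at hFu
    have hFu' : ∀ t ∈ Icc 0 T, ∀ᵐ s, s ∈ uIoc 0 t →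
        F s = jointField f g ((P.1 s, P.2.1 s), u s) := by
      intro t ht
      filter_upwards [hFu] with s hs hst
      rw [uIoc_of_le ht.1] at hst
      exact hs ⟨hst.1.le, hst.2.trans ht.2⟩
    refine ⟨hpeak, u, hu, huU, fun t ht => ?_, fun t ht => ?_, ?_⟩
    · refine (hw.fst_snd_eq ht).1.trans (congrArg (x₀ + ·) ?_)
      refine intervalIntegral.integral_congr_ae ?_
      filter_upwards [hFu' t ht] with s hs hst using congrArg Prod.fst (hs hst)
    · refine (hw.fst_snd_eq ht).2.trans (congrArg (y₀ + ·) ?_)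
      refine intervalIntegral.integral_congr_ae ?_
      filter_upwards [hFu' t ht] with s hs hst using congrArg Prod.snd (hs hst)
    · intro u' x' y' hu' huU' hx'c hy'c hx' hy'
      obtain ⟨z, hz, hzle⟩ := (isTrajectory_of_control hfc hgc hgrowth hu' huU' hx'c hy'c
        hx' hy').exists_mem_solSetP3 hT.le hC.le hgrowth
      rw [← hpeak]
      exact (hPmin _ hz).trans (hzle _ (le_sSup_peak y' hy'c.continuousOn))
end

section
/- Let T > 0, let U ⊆ ℝᵖ be a nonempty compact set, and let f : ℝⁿ × ℝ × ℝᵖ → ℝⁿ and g : ℝⁿ × ℝ × ℝᵖ → ℝ be continuously differentiable with linear growth, such that for every (x,y) the set {(f(x,y,u), g(x,y,u)) : u ∈ U} is convex. Fix (x₀,y₀) and let V denote the optimal value of problem P, i.e. the infimum over measurable controls u : [0,T] → U of sup_{t∈[0,T]} y(t) for the solution of ẋ = f(x,y,u(t)), ẏ = g(x,y,u(t)) with (x(0),y(0)) = (x₀,y₀). For θ > 0, let V_θ denote the infimum of z(T) over absolutely continuous solutions (x,y,z) of ẋ = f(x,y,u(t)), ẏ = g(x,y,u(t)), ż = max(g(x,y,u(t)),0)·(1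 − v(t)·e^{−θ·max(y−z,0)}) with (x(0),y(0),z(0)) = (x₀,y₀,y₀) and measurable controls u : [0,T] → U, v : [0,T] → [0,1]. Then for every θ > 0 the infimum V_θ is attained, the map θ ↦ V_θ is nondecreasing, V_θ ≤ V for all θ > 0, and V_θ → V as θ → +∞. -/
open MeasureTheory Set

/-- Values `sup_{[0,T]} y` of problem `P` (peak minimization for
`ẋ = f, ẏ = g` with initial condition `(x₀,y₀)`). -/
def valuesP (n p : ℕ) (T : ℝ) (U : Set (EuclideanSpace ℝ (Fin p)))
    (f : EuclideanSpace ℝ (Fin n) × ℝ × EuclideanSpace ℝ (Fin p) → EuclideanSpace ℝ (Fin n))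
    (g : EuclideanSpace ℝ (Fin n) × ℝ × EuclideanSpace ℝ (Fin p) → ℝ)
    (x₀ : EuclideanSpace ℝ (Fin n)) (y₀ : ℝ) : Set ℝ :=
  {r : ℝ |
    ∃ (u : ℝ → EuclideanSpace ℝ (Fin p)) (x : ℝ → EuclideanSpace ℝ (Fin n)) (y : ℝ → ℝ),
      Measurable u ∧ (∀ t, u t ∈ U) ∧ Continuous x ∧ Continuous y ∧
      x 0 = x₀ ∧ y 0 = y₀ ∧
      (∀ t ∈ Icc 0 T, x t = x₀ + ∫ s in (0:ℝ)..t, f (x s, y s, u s)) ∧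
      (∀ t ∈ Icc 0 T, y t = y₀ + ∫ s in (0:ℝ)..t, g (x s, y s, u s)) ∧
      r = sSup (y '' Icc 0 T)}

/-- Values `z(T)` of the regularized Mayer problem `P₃^θ`, for the unconstrained
dynamics `ẋ = f, ẏ = g, ż = max(g,0)(1 − v·e^{−θ·max(y−z,0)})` with initial
condition `(x₀,y₀,y₀)` and controls `u` valued in `U`, `v` valued in `[0,1]`. -/
def valuesP3theta (n p : ℕ) (T : ℝ) (U : Set (EuclideanSpace ℝ (Fin p)))
    (f : EuclideanSpace ℝ (Fin n) × ℝ × EuclideanSpace ℝ (Fin p) → EuclideanSpace ℝ (Fin n))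
    (g : EuclideanSpace ℝ (Fin n) × ℝ × EuclideanSpace ℝ (Fin p) → ℝ)
    (x₀ : EuclideanSpace ℝ (Fin n)) (y₀ : ℝ) (θ : ℝ) : Set ℝ :=
  {r : ℝ |
    ∃ (u : ℝ → EuclideanSpace ℝ (Fin p)) (v : ℝ → ℝ)
      (x : ℝ → EuclideanSpace ℝ (Fin n)) (y z : ℝ → ℝ),
      Measurable u ∧ (∀ t, u t ∈ U) ∧ Measurable v ∧ (∀ t, v t ∈ Icc (0:ℝ) 1) ∧
      Continuous x ∧ Continuous y ∧ Continuous z ∧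
      x 0 = x₀ ∧ y 0 = y₀ ∧ z 0 = y₀ ∧
      (∀ t ∈ Icc 0 T, x t = x₀ + ∫ s in (0:ℝ)..t, f (x s, y s, u s)) ∧
      (∀ t ∈ Icc 0 T, y t = y₀ + ∫ s in (0:ℝ)..t, g (x s, y s, u s)) ∧
      (∀ t ∈ Icc 0 T, z t = y₀ + ∫ s in (0:ℝ)..t,
        max (g (x s, y s, u s)) 0 * (1 - v s * Real.exp (-θ * max (y s - z s) 0))) ∧
      r = z T}

section Helpers

open Filter Topology

/-- A continuous vector field evaluated along a continuous curve and a measurable control with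
values in a compact set is interval integrable. -/
theorem intervalIntegrable_comp_control {S W G : Type*} [TopologicalSpace S]
    [MeasurableSpace S] [BorelSpace S] [SecondCountableTopology S]
    [TopologicalSpace W] [MeasurableSpace W] [BorelSpace W] [SecondCountableTopology W]
    [NormedAddCommGroup G] [SecondCountableTopology G]
    {Ψ : S × W → G} (hΨ : Continuous Ψ) {q : ℝ → S} (hq : Continuous q)
    {w : ℝ → W} (hw : Measurable w) {V : Set W} (hV : IsCompact V) (hwV : ∀ t, w t ∈ V)
    (a b : ℝ) : IntervalIntegrable (fun s => Ψ (q s, w s)) volume a b := by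
  borelize G
  have hm : Measurable fun s => Ψ (q s, w s) :=
    hΨ.measurable.comp (hq.measurable.prodMk hw)
  obtain ⟨M, hM⟩ := ((isCompact_uIcc (a := a) (b := b)).image hq |>.prod hV).exists_bound_of_continuousOn
    hΨ.continuousOn
  rw [intervalIntegrable_iff]
  refine Measure.integrableOn_of_bounded (M := M) (by simp) hm.aestronglyMeasurable ?_
  refine (ae_restrict_iff' measurableSet_uIoc).2 (.of_forall fun s hs => ?_)
  exact hM _ ⟨mem_image_of_mem _ (uIoc_subset_uIcc hs), hwV s⟩

theorem exists_caratheodory_solution {E : Type*} [NormedAddCommGroup E] [NormedSpace ℝ E]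
    [CompleteSpace E] {F : ℝ → E → E} {K T : ℝ} (hK : 0 ≤ K) (hT : 0 ≤ T)
    (hF : ∀ t x x', ‖F t x - F t x'‖ ≤ K * ‖x - x'‖)
    (hint : ∀ w : ℝ → E, Continuous w → ∀ a b,
      IntervalIntegrable (fun s => F s (w s)) volume a b) (x₀ : E) :
    ∃ X : ℝ → E, Continuous X ∧ X 0 = x₀ ∧
      ∀ t ∈ Icc 0 T, X t = x₀ + ∫ s in (0:ℝ)..t, F s (X s) := by
  set L : ℝ := 2 * K + 1 with hL
  have hLpos : 0 < L := by positivity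
  let ext : C(Icc 0 T, E) → ℝ → E := fun w s => Real.exp (L * s) • IccExtend hT w s
  have hext : ∀ w, Continuous (ext w) := fun w => by
    have : Continuous (IccExtend hT w) := w.continuous.Icc_extend'
    fun_prop
  let Φ : C(Icc 0 T, E) → C(Icc 0 T, E) := fun w =>
    ⟨fun t => Real.exp (-(L * t)) • (x₀ + ∫ s in (0:ℝ)..t, F s (ext w s)), by
      have h1 : Continuous fun t : ℝ => ∫ s in (0:ℝ)..t, F s (ext w s) :=
        intervalIntegral.continuous_primitive (hint _ (hext w)) 0
      have h2 : Continuous fun t : Icc 0 T => ∫ s in (0:ℝ)..t, F s (ext w s) :=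
        h1.comp continuous_subtype_val
      fun_prop⟩
  have hΦ : ContractingWith (1 / 2) Φ := by
    refine ⟨by norm_num, LipschitzWith.of_dist_le_mul fun w w' => ?_⟩
    rw [ContinuousMap.dist_le (by positivity)]
    intro t
    have ht := t.2
    have hbound : ‖∫ s in (0:ℝ)..t, (F s (ext w s) - F s (ext w' s))‖
        ≤ ∫ s in (0:ℝ)..t, K * dist w w' * Real.exp (L * s) := by
      refine intervalIntegral.norm_integral_le_of_norm_le ht.1 (.of_forall fun s hs => ?_)
        (by apply Continuous.intervalIntegrable; fun_prop)
      refine (hF _ _ _).trans ?_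
      have : ext w s - ext w' s
          = Real.exp (L * s) • (IccExtend hT w s - IccExtend hT w' s) := by
        simp [ext, smul_sub]
      rw [this, norm_smul, Real.norm_of_nonneg (Real.exp_pos _).le]
      have h3 : ‖IccExtend hT w s - IccExtend hT w' s‖ ≤ dist w w' := by
        rw [← dist_eq_norm]
        exact ContinuousMap.dist_apply_le_dist _
      calc K * (Real.exp (L * s) * ‖IccExtend hT w s - IccExtend hT w' s‖)
          ≤ K * (Real.exp (L * s) * dist w w') := by gcongr
        _ = _ := by ring
    have hcalc : ∫ s in (0:ℝ)..t, K * dist w w' * Real.exp (L * s)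
        = K * dist w w' * ((Real.exp (L * t) - 1) / L) := by
      rw [intervalIntegral.integral_const_mul,
        intervalIntegral.integral_comp_mul_left (fun x => Real.exp x) hLpos.ne', integral_exp]
      simp [div_eq_inv_mul]
    rw [hcalc] at hbound
    have hd : dist (Φ w t) (Φ w' t) = Real.exp (-(L * t)) *
        ‖∫ s in (0:ℝ)..t, (F s (ext w s) - F s (ext w' s))‖ := by
      rw [intervalIntegral.integral_sub (hint _ (hext w) _ _) (hint _ (hext w') _ _),
        dist_eq_norm]
      simp only [Φ, ContinuousMap.coe_mk]
      rw [← smul_sub, norm_smul, Real.norm_of_nonneg (Real.exp_pos _).le, add_sub_add_left_eq_sub]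
    rw [hd]
    have hKL : K / L ≤ 1 / 2 := by
      rw [div_le_div_iff₀ hLpos two_pos]; linarith
    have hdn : 0 ≤ dist w w' := dist_nonneg
    calc Real.exp (-(L * t)) * ‖∫ s in (0:ℝ)..t, (F s (ext w s) - F s (ext w' s))‖
        ≤ Real.exp (-(L * t)) * (K * dist w w' * ((Real.exp (L * t) - 1) / L)) := by gcongr
      _ = K / L * dist w w' * (1 - Real.exp (-(L * t))) := by
          have : Real.exp (-(L * t)) * Real.exp (L * t) = 1 := by
            rw [← Real.exp_add]; simp
          field_simp
          linear_combination (K * dist w w') * this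
      _ ≤ K / L * dist w w' * 1 := by
          gcongr
          linarith [Real.exp_pos (-(L * t))]
      _ ≤ 1 / 2 * dist w w' := by rw [mul_one]; gcongr
      _ = _ := by norm_num
  let w := hΦ.fixedPoint
  have hw : Φ w = w := hΦ.fixedPoint_isFixedPt
  have key : ∀ t ∈ Icc 0 T, ext w t = x₀ + ∫ s in (0:ℝ)..t, F s (ext w s) := by
    intro t ht
    have h1 : w ⟨t, ht⟩ = Real.exp (-(L * t)) • (x₀ + ∫ s in (0:ℝ)..t, F s (ext w s)) := by
      conv_lhs => rw [← hw]
      rfl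
    have h2 : ext w t = Real.exp (L * t) • w ⟨t, ht⟩ := by
      simp only [ext, IccExtend_of_mem _ _ ht]
    rw [h2, h1, smul_smul, ← Real.exp_add]
    simp
  exact ⟨ext w, hext w, by rw [key 0 ⟨le_rfl, hT⟩]; simp, key⟩

theorem norm_le_of_integral_growth {E : Type*} [NormedAddCommGroup E] [NormedSpace ℝ E]
    {X G : ℝ → E} {C T : ℝ} (hC : 0 ≤ C) (hX : Continuous X) {x₀ : E}
    (h : ∀ t ∈ Icc 0 T, X t = x₀ + ∫ s in (0:ℝ)..t, G s)
    (hG : ∀ s ∈ Icc 0 T, ‖G s‖ ≤ C * (1 + ‖X s‖)) :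
    ∀ t ∈ Icc 0 T, ‖X t‖ ≤ (1 + ‖x₀‖) * Real.exp (C * T) := by
  let φ : ℝ → ℝ := fun t => 1 + ‖x₀‖ + ∫ s in (0:ℝ)..t, C * (1 + ‖X s‖)
  have hcont : Continuous fun s => C * (1 + ‖X s‖) := by fun_prop
  have hle : ∀ t ∈ Icc 0 T, 1 + ‖X t‖ ≤ φ t := by
    intro t ht
    have : ‖∫ s in (0:ℝ)..t, G s‖ ≤ ∫ s in (0:ℝ)..t, C * (1 + ‖X s‖) :=
      intervalIntegral.norm_integral_le_of_norm_le ht.1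
        (.of_forall fun s hs => hG s ⟨hs.1.le, hs.2.trans ht.2⟩) (hcont.intervalIntegrable _ _)
    have h2 := norm_add_le x₀ (∫ s in (0:ℝ)..t, G s)
    rw [← h t ht] at h2
    simp only [φ]
    linarith
  have hder : ∀ t, HasDerivAt φ (C * (1 + ‖X t‖)) t := fun t =>
    (hcont.integral_hasStrictDerivAt 0 t).hasDerivAt.const_add _
  have hφc : Continuous φ := continuous_iff_continuousAt.2 fun t => (hder t).continuousAt
  intro t ht
  have := norm_le_gronwallBound_of_norm_deriv_right_le (f := φ) (δ := 1 + ‖x₀‖) (K := C) (ε := 0)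
    (a := 0) (b := T) hφc.continuousOn (fun x _ => (hder x).hasDerivWithinAt)
    (by simp [φ, abs_of_nonneg (by positivity : (0:ℝ) ≤ 1 + ‖x₀‖)])
    (fun x hx => by
      have hx' := hle x ⟨hx.1, hx.2.le⟩
      rw [Real.norm_of_nonneg (by positivity), add_zero]
      gcongr
      exact hx'.trans (le_abs_self _)) t ht
  rw [gronwallBound_ε0, sub_zero] at this
  calc ‖X t‖ ≤ 1 + ‖X t‖ := by linarith
    _ ≤ φ t := hle t ht
    _ ≤ ‖φ t‖ := le_abs_self _
    _ ≤ _ := this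
    _ ≤ _ := by gcongr; exact ht.2

theorem le_add_of_le_add_on_superlevel {D : ℝ → ℝ} {T c η : ℝ} (hD : ContinuousOn D (Icc 0 T))
    (h0 : D 0 ≤ c) (hη : 0 ≤ η)
    (h : ∀ τ ∈ Icc 0 T, ∀ t ∈ Icc τ T, (∀ s ∈ Ioc τ t, c < D s) → D t ≤ D τ + η * (t - τ)) :
    ∀ t ∈ Icc 0 T, D t ≤ c + η * T := by
  intro t ht
  let A := Icc 0 t ∩ D ⁻¹' Iic c
  have hA : IsCompact A := isCompact_Icc.of_isClosed_subset
    ((hD.mono (Icc_subset_Icc_right ht.2)).preimage_isClosed_of_isClosed isClosed_Icc isClosed_Iic)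
    inter_subset_left
  obtain ⟨τ, hτ, hmax⟩ := hA.exists_isGreatest ⟨0, ⟨le_rfl, ht.1⟩, h0⟩
  have h1 := h τ ⟨hτ.1.1, hτ.1.2.trans ht.2⟩ t ⟨hτ.1.2, ht.2⟩ fun s hs => by
    by_contra! hcs
    exact absurd (hmax ⟨⟨hτ.1.1.trans hs.1.le, hs.2⟩, hcs⟩) (not_le.2 hs.1)
  have h2 : D τ ≤ c := hτ.2
  have h3 : η * (t - τ) ≤ η * T := by
    gcongr
    linarith [hτ.1.1, ht.2]
  linarith

theorem measurable_iInf_of_compact {Ω X : Type*} [MeasurableSpace Ω] [TopologicalSpace X]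
    [CompactSpace X] [TopologicalSpace.SeparableSpace X] [Nonempty X] {h : Ω → X → ℝ}
    (hm : ∀ x, Measurable fun t => h t x) (hc : ∀ t, Continuous (h t)) :
    Measurable fun t => ⨅ x, h t x := by
  have heq : (fun t => ⨅ x, h t x) =
      fun t => ⨅ i, h t (TopologicalSpace.denseSeq X i) := by
    funext t
    have hbdd : BddBelow (range (h t)) := (isCompact_range (hc t)).bddBelow
    refine le_antisymm (le_ciInf fun i => ciInf_le hbdd _) (le_ciInf fun x => ?_)
    refine (TopologicalSpace.denseRange_denseSeq X).induction_on x
      (isClosed_le continuous_const (hc t)) fun i => ?_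
    exact ciInf_le (hbdd.mono (range_comp_subset_range _ (h t))) i
  rw [heq]
  exact Measurable.iInf fun i => hm _

theorem exists_measurable_argmin_real {Ω : Type*} [MeasurableSpace Ω] {K : Set ℝ}
    (hK : IsCompact K) (hKne : K.Nonempty) {h : Ω → K → ℝ}
    (hm : ∀ k, Measurable fun t => h t k) (hc : ∀ t, Continuous (h t)) :
    ∃ s : Ω → K, Measurable s ∧ ∀ t k, h t (s t) ≤ h t k := by
  have := isCompact_iff_compactSpace.1 hK
  have := hKne.to_subtype
  have hmin : ∀ t, ∃ k, ∀ k', h t k ≤ h t k' := fun t => by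
    obtain ⟨k, -, hk⟩ := isCompact_univ.exists_isMinOn univ_nonempty (hc t).continuousOn
    exact ⟨k, fun k' => hk (mem_univ k')⟩
  have hex : ∀ t, ∃ k, IsLeast {k | ∀ k', h t k ≤ h t k'} k := fun t => by
    have hcl : IsClosed {k | ∀ k', h t k ≤ h t k'} := by
      simp only [ofPred_forall]
      exact isClosed_iInter fun k' => isClosed_le (hc t) continuous_const
    exact hcl.isCompact.exists_isLeast (hmin t)
  choose s hs using hex
  refine ⟨s, ?_, fun t => (hs t).1⟩
  refine Measurable.subtype_mk (f := fun t => (s t : ℝ)) (measurable_of_Iic fun c => ?_)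
    (h := fun t => (s t).2)
  have hBc : IsCompact {k : K | (k : ℝ) ≤ c} :=
    (isClosed_le continuous_subtype_val continuous_const).isCompact
  have := isCompact_iff_compactSpace.1 hBc
  rcases isEmpty_or_nonempty {k : K | (k : ℝ) ≤ c} with hB | hB
  · convert MeasurableSet.empty
    ext t
    simp only [mem_preimage, mem_Iic, mem_empty_iff_false, iff_false]
    exact fun hle => hB.false ⟨s t, hle⟩
  · have hset : (fun t => (s t : ℝ)) ⁻¹' Iic c =
        {t | ⨅ k : {k : K | (k : ℝ) ≤ c}, h t k ≤ ⨅ k, h t k} := by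
      ext t
      have hcB : Continuous fun k : {k : K | (k : ℝ) ≤ c} => h t k :=
        (hc t).comp continuous_subtype_val
      have hbdd : BddBelow (range fun k : {k : K | (k : ℝ) ≤ c} => h t k) :=
        (isCompact_range hcB).bddBelow
      constructor
      · intro hle
        exact le_ciInf fun k => (ciInf_le hbdd ⟨s t, hle⟩).trans ((hs t).1 k)
      · intro hle
        obtain ⟨k, -, hk⟩ := isCompact_univ.exists_isMinOn univ_nonempty hcB.continuousOn
        have h1 : (k : K) ∈ {k | ∀ k', h t k ≤ h t k'} := fun k' =>
          (le_ciInf fun b => hk (mem_univ b)).trans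
            (hle.trans (ciInf_le (isCompact_range (hc t)).bddBelow k'))
        exact le_trans (Subtype.coe_le_coe.2 ((hs t).2 h1)) k.2
    rw [hset]
    exact measurableSet_le
      (measurable_iInf_of_compact (fun k => hm _) fun t => (hc t).comp continuous_subtype_val)
      (measurable_iInf_of_compact hm hc)

/-- Measurable selection of a minimizer of a Carathéodory function over a compact set. -/
theorem exists_measurable_argmin {Ω W : Type*} [MeasurableSpace Ω] [MetricSpace W]
    [MeasurableSpace W] [BorelSpace W] {U : Set W} (hU : IsCompact U) (hUne : U.Nonempty)
    {h : Ω → W → ℝ} (hm : ∀ u, Measurable fun t => h t u) (hc : ∀ t, Continuous (h t)) :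
    ∃ u : Ω → W, Measurable u ∧ ∀ t, u t ∈ U ∧ ∀ u' ∈ U, h t (u t) ≤ h t u' := by
  have := isCompact_iff_compactSpace.1 hU
  have := hUne.to_subtype
  obtain ⟨φ, hφc, hφs⟩ := exists_nat_bool_continuous_surjective_of_compact U
  let ψ : cantorSet → U := φ ∘ cantorSetHomeomorphNatToBool
  have hψc : Continuous ψ := hφc.comp (Homeomorph.continuous _)
  have hψs : Function.Surjective ψ := hφs.comp (Homeomorph.surjective _)
  obtain ⟨s, hsm, hs⟩ := exists_measurable_argmin_real isCompact_cantorSet ⟨0, zero_mem_cantorSet⟩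
    (h := fun t k => h t (ψ k)) (fun k => hm _)
    (fun t => (hc t).comp (continuous_subtype_val.comp hψc))
  refine ⟨fun t => ψ (s t), (continuous_subtype_val.comp hψc).measurable.comp hsm,
    fun t => ⟨(ψ (s t)).2, fun u' hu' => ?_⟩⟩
  obtain ⟨k, hk⟩ := hψs ⟨u', hu'⟩
  have := hs t k
  rwa [hk] at this

theorem eq_add_integral_of_ae_hasDerivAt {E : Type*} [NormedAddCommGroup E] [NormedSpace ℝ E]
    [CompleteSpace E] {X G : ℝ → E} {T : ℝ} {A : NNReal} (hX : LipschitzWith A X)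
    (hG : ∀ a b, IntervalIntegrable G volume a b) {M : NNReal} (hM : ∀ s ∈ Icc 0 T, ‖G s‖ ≤ M)
    (hd : ∀ᵐ t, t ∈ Ioo 0 T → HasDerivAt X (G t) t) :
    ∀ t ∈ Icc 0 T, X t = X 0 + ∫ s in (0:ℝ)..t, G s := by
  intro t ht
  have hT : 0 ≤ T := ht.1.trans ht.2
  have hint : LipschitzOnWith M (fun x => ∫ s in (0:ℝ)..x, G s) (uIcc 0 T) := by
    rw [uIcc_of_le hT]
    refine LipschitzOnWith.of_dist_le_mul fun x hx y hy => ?_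
    rw [dist_eq_norm, intervalIntegral.integral_interval_sub_left (hG _ _) (hG _ _)]
    exact (intervalIntegral.norm_integral_le_of_norm_le_const fun s hs =>
      hM s (uIcc_subset_Icc hy hx (uIoc_subset_uIcc hs))).trans_eq (by rw [Real.dist_eq])
  have hac := (hX.lipschitzOnWith (s := uIcc 0 T)).absolutelyContinuousOnInterval.sub
    hint.absolutelyContinuousOnInterval
  have h0 : ∀ᵐ x : ℝ, x ≠ 0 := by simp [ae_iff, measure_singleton]
  have h1 : ∀ᵐ x : ℝ, x ≠ T := by simp [ae_iff, measure_singleton]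
  obtain ⟨c, hc⟩ := hac.const_of_ae_hasDerivAt_zero (by
    filter_upwards [hd, (hG 0 T).ae_hasDerivAt_integral, h0, h1] with x hx hx' hx0 hxT hmem
    have hmem' := hmem
    rw [uIcc_of_le hT] at hmem'
    have := (hx ⟨lt_of_le_of_ne hmem'.1 hx0.symm, lt_of_le_of_ne hmem'.2 hxT⟩).sub
      (hx' hmem 0 left_mem_uIcc)
    rwa [sub_self] at this)
  have e1 := hc t (by rwa [uIcc_of_le hT])
  have e2 := hc 0 left_mem_uIcc
  simp only [Pi.sub_apply, intervalIntegral.integral_same, sub_zero] at e1 e2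
  rw [e2, ← e1]
  abel

theorem exists_lipschitz_hyperfilter_limit {S : Type*} [MetricSpace S] [ProperSpace S]
    {q : ℕ → ℝ → S} {T : ℝ} (hT : 0 ≤ T) {A : NNReal}
    (hLip : ∀ k, LipschitzOnWith A (q k) (Icc 0 T)) {B : Set S} (hB : IsCompact B)
    (hqB : ∀ k, ∀ t ∈ Icc 0 T, q k t ∈ B) :
    ∃ Q : ℝ → S, LipschitzWith A Q ∧
      ∀ t ∈ Icc 0 T, Tendsto (fun k => q k t) (hyperfilter ℕ : Filter ℕ) (𝓝 (Q t)) := by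
  have hlim : ∀ t : Icc (0:ℝ) T, ∃ x,
      Tendsto (fun k => q k t) (hyperfilter ℕ : Filter ℕ) (𝓝 x) := fun t => by
    obtain ⟨x, -, hx⟩ := hB.ultrafilter_le_nhds' ((hyperfilter ℕ).map fun k => q k t)
      (Ultrafilter.mem_map.2 (Filter.univ_mem' fun k => hqB k t t.2))
    exact ⟨x, hx⟩
  choose Q hQ using hlim
  have hQL : LipschitzWith A Q := LipschitzWith.of_dist_le_mul fun s t =>
    le_of_tendsto ((hQ s).dist (hQ t)) (.of_forall fun k => (hLip k).dist_le_mul _ s.2 _ t.2)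
  refine ⟨Q ∘ projIcc 0 T hT, ?_, fun t ht => ?_⟩
  · simpa using hQL.comp (LipschitzWith.projIcc hT)
  · simpa only [Function.comp_apply, projIcc_of_mem hT ht] using hQ ⟨t, ht⟩

/-- The derivative of a limit of trajectories lies in every closed convex set containing the
velocity set at the limit point. -/
theorem deriv_mem_of_limit_trajectories {S W : Type*} [NormedAddCommGroup S] [NormedSpace ℝ S]
    [CompleteSpace S] [SecondCountableTopology S] [MeasurableSpace S] [BorelSpace S]
    [TopologicalSpace W] [MeasurableSpace W] [BorelSpace W] [SecondCountableTopology W]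
    {Ψ : S × W → S} (hΨ : Continuous Ψ) {V : Set W} (hV : IsCompact V)
    {q : ℕ → ℝ → S} {w : ℕ → ℝ → W} (hq : ∀ k, Continuous (q k)) (hw : ∀ k, Measurable (w k))
    (hwV : ∀ k t, w k t ∈ V) {q₀ : S} {T : ℝ}
    (htraj : ∀ k, ∀ t ∈ Icc 0 T, q k t = q₀ + ∫ s in (0:ℝ)..t, Ψ (q k s, w k s))
    {A : NNReal} (hLip : ∀ k, LipschitzOnWith A (q k) (Icc 0 T))
    {l : Filter ℕ} [l.NeBot] {Q : ℝ → S}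
    (hlim : ∀ t ∈ Icc 0 T, Tendsto (fun k => q k t) l (𝓝 (Q t)))
    {t : ℝ} (ht : t ∈ Ioo 0 T) {d : S} (hd : HasDerivAt Q d t)
    {P : Set S} (hPc : IsClosed P) (hPconv : Convex ℝ P) (hP : ∀ u ∈ V, Ψ (Q t, u) ∈ P) :
    d ∈ P := by
  have hint : ∀ k a b, IntervalIntegrable (fun s => Ψ (q k s, w k s)) volume a b := fun k a b =>
    intervalIntegrable_comp_control hΨ (hq k) (hw k) hV (hwV k) a b
  have hall : ∀ ε : ℝ, 0 < ε → d ∈ Metric.cthickening ε P := by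
    intro ε hε
    obtain ⟨N, hN, hNε⟩ := hV.mem_uniformity_of_prod (f := fun x u => Ψ (x, u)) (s := univ)
      (q := Q t) hΨ.continuousOn (mem_univ _) (Metric.dist_mem_uniformity hε)
    rw [nhdsWithin_univ] at hN
    obtain ⟨r, hr, hrN⟩ := Metric.mem_nhds_iff.1 hN
    have htI : t ∈ Icc 0 T := Ioo_subset_Icc_self ht
    have hAr : 0 < r / 2 / (A + 1) := by positivity
    have hslope : ∀ᶠ h in 𝓝[>] (0:ℝ), h⁻¹ • (Q (t + h) - Q t) ∈ Metric.cthickening ε P := by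
      filter_upwards [Ioc_mem_nhdsGT (lt_min (sub_pos.2 ht.2) hAr)] with h hh
      have hh0 : 0 < h := hh.1
      have hhT : t + h ≤ T := by linarith [hh.2.trans (min_le_left _ _)]
      have hhA : A * h ≤ r / 2 := by
        have h2 := hh.2.trans (min_le_right _ _)
        rw [le_div_iff₀ (by positivity)] at h2
        nlinarith
      have hthI : t + h ∈ Icc 0 T := ⟨by linarith [ht.1], hhT⟩
      refine Metric.isClosed_cthickening.mem_of_tendsto
        (((hlim _ hthI).sub (hlim _ htI)).const_smul h⁻¹) ?_
      filter_upwards [Metric.tendsto_nhds.1 (hlim t htI) (r / 2) (by positivity)] with k hk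
      have hdiff : q k (t + h) - q k t = ∫ s in t..(t + h), Ψ (q k s, w k s) := by
        rw [htraj k _ hthI, htraj k _ htI, add_sub_add_left_eq_sub,
          intervalIntegral.integral_interval_sub_left (hint _ _ _) (hint _ _ _)]
      have havg : h⁻¹ • (q k (t + h) - q k t) = ⨍ s in Ioc t (t + h), Ψ (q k s, w k s) := by
        rw [hdiff, setAverage_eq, intervalIntegral.integral_of_le (by linarith)]
        simp [hh0.le]
      rw [havg]
      refine (hPconv.cthickening ε).set_average_mem Metric.isClosed_cthickening (by simp [hh0])
        (by simp) ?_ ((intervalIntegrable_iff_integrableOn_Ioc_of_le (by linarith)).1 (hint k _ _))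
      refine (ae_restrict_iff' measurableSet_Ioc).2 (.of_forall fun s hs => ?_)
      have hsI : s ∈ Icc 0 T := ⟨by linarith [hs.1, ht.1], hs.2.trans hhT⟩
      have hclose : dist (q k s) (Q t) < r := by
        have h1 := (hLip k).dist_le_mul _ hsI _ htI
        have h2 : (A : ℝ) * dist s t ≤ A * h := by
          gcongr
          rw [Real.dist_eq, abs_of_pos (by linarith [hs.1])]
          linarith [hs.2]
        linarith [dist_triangle (q k s) (q k t) (Q t)]
      exact Metric.mem_cthickening_of_dist_le _ _ _ _ (hP _ (hwV k s))
        (le_of_lt (hNε _ (hrN hclose) _ (hwV k s)))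
    refine Metric.isClosed_cthickening.mem_of_tendsto ?_ hslope
    have := hasDerivAt_iff_tendsto_slope_zero.1 hd
    exact this.mono_left (nhdsWithin_mono _ fun x hx => ne_of_gt hx)
  have h1 : d ∈ closure P := by
    rw [Metric.closure_eq_iInter_cthickening P]
    exact mem_iInter₂.2 hall
  rwa [hPc.closure_eq] at h1

theorem exists_solution_of_linear_growth {S : Type*} [NormedAddCommGroup S] [NormedSpace ℝ S]
    [FiniteDimensional ℝ S] {F : S → S} (hF : ContDiff ℝ 1 F) {C T : ℝ} (hC : 0 ≤ C)
    (hT : 0 ≤ T) (hgrowth : ∀ q, ‖F q‖ ≤ C * (1 + ‖q‖)) (q₀ : S) :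
    ∃ q : ℝ → S, Continuous q ∧ q 0 = q₀ ∧
      ∀ t ∈ Icc 0 T, q t = q₀ + ∫ s in (0:ℝ)..t, F (q s) := by
  have := FiniteDimensional.complete ℝ S
  set R : ℝ := (1 + ‖q₀‖) * Real.exp (C * T)
  have hR : 0 < R := by positivity
  let χ : ContDiffBump (0 : S) := ⟨R, R + 1, hR, by linarith⟩
  have hsmooth : ContDiff ℝ 1 fun q => χ q • F q := χ.contDiff.smul hF
  obtain ⟨K, hK⟩ := hsmooth.lipschitzWith_of_hasCompactSupport
    (χ.hasCompactSupport.smul_right) one_ne_zero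
  obtain ⟨q, hq, hq0, hqt⟩ := exists_caratheodory_solution (F := fun _ q => χ q • F q) K.2 hT
    (fun _ x x' => by
      have := hK.dist_le_mul x x'
      rwa [dist_eq_norm, dist_eq_norm] at this)
    (fun w hw a b => (hsmooth.continuous.comp hw).intervalIntegrable a b) q₀
  have hbound := norm_le_of_integral_growth hC hq hqt fun s _ => by
    rw [norm_smul, Real.norm_of_nonneg χ.nonneg]
    exact (mul_le_of_le_one_left (norm_nonneg _) χ.le_one).trans (hgrowth _)
  refine ⟨q, hq, hq0, fun t ht => ?_⟩
  rw [hqt t ht]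
  congr 1
  refine intervalIntegral.integral_congr fun s hs => ?_
  rw [uIcc_of_le ht.1] at hs
  have h1 : χ (q s) = 1 := χ.one_of_mem_closedBall <| by
    rw [mem_closedBall_zero_iff]
    exact hbound s ⟨hs.1, hs.2.trans ht.2⟩
  simp [h1]

theorem intervalIntegral_prodMk_s9 {E F : Type*} [NormedAddCommGroup E] [NormedSpace ℝ E]
    [CompleteSpace E] [NormedAddCommGroup F] [NormedSpace ℝ F] [CompleteSpace F]
    {a b : ℝ} {φ : ℝ → E} {ψ : ℝ → F} (hφ : IntervalIntegrable φ volume a b)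
    (hψ : IntervalIntegrable ψ volume a b) :
    ∫ s in a..b, (φ s, ψ s) = (∫ s in a..b, φ s, ∫ s in a..b, ψ s) := by
  simp only [intervalIntegral.intervalIntegral_eq_integral_uIoc]
  rw [integral_pair (intervalIntegrable_iff.1 hφ) (intervalIntegrable_iff.1 hψ), Prod.smul_mk]

theorem abs_exp_neg_sub_exp_neg_le {a b : ℝ} (ha : 0 ≤ a) (hb : 0 ≤ b) :
    |Real.exp (-a) - Real.exp (-b)| ≤ |a - b| := by
  wlog hab : a ≤ b generalizing a b
  · rw [abs_sub_comm, abs_sub_comm a]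
    exact this hb ha (le_of_not_ge hab)
  have h1 : Real.exp (-b) ≤ Real.exp (-a) := Real.exp_le_exp.2 (by linarith)
  rw [abs_of_nonneg (by linarith), abs_sub_comm, abs_of_nonneg (by linarith)]
  have h2 : Real.exp (-b) = Real.exp (-a) * Real.exp (-(b - a)) := by
    rw [← Real.exp_add]; ring_nf
  have h3 := Real.add_one_le_exp (-(b - a))
  have h4 : Real.exp (-a) ≤ 1 := Real.exp_le_one_iff.2 (by linarith)
  have h5 := Real.exp_pos (-a)
  rw [h2]
  nlinarith

theorem norm_velocity_le_of_growth {E : Type*} [NormedAddCommGroup E] {a x : E} {b y C : ℝ}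
    (hC : 0 ≤ C)
    (h : ‖a‖ + |b| ≤ C * (1 + ‖x‖ + |y|)) : ‖(a, b)‖ ≤ 2 * C * (1 + ‖(x, y)‖) := by
  have h1 : ‖x‖ ≤ ‖(x, y)‖ := norm_fst_le (x, y)
  have h2 : |y| ≤ ‖(x, y)‖ := norm_snd_le (x, y)
  have h3 : ‖(a, b)‖ ≤ ‖a‖ + |b| :=
    max_le (by linarith [abs_nonneg b]) (by rw [Real.norm_eq_abs]; linarith [norm_nonneg a])
  have h4 : C * (1 + ‖x‖ + |y|) ≤ C * (2 * (1 + ‖(x, y)‖)) := by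
    gcongr
    linarith
  linarith

/-- `(x, y)` solves `ẋ = f, ẏ = g` on `[0,T]` from `(x₀, y₀)`, with measurable control `u`. -/
structure IsControlledTrajectory {E W : Type*} [NormedAddCommGroup E] [NormedSpace ℝ E]
    [MeasurableSpace W] (T : ℝ) (U : Set W) (f : E × ℝ × W → E) (g : E × ℝ × W → ℝ)
    (x₀ : E) (y₀ : ℝ) (u : ℝ → W) (x : ℝ → E) (y : ℝ → ℝ) : Prop where
  measurable_control : Measurable u
  control_mem : ∀ t, u t ∈ U
  continuous_fst : Continuous x
  continuous_snd : Continuous y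
  fst_zero : x 0 = x₀
  snd_zero : y 0 = y₀
  fst_eq : ∀ t ∈ Icc 0 T, x t = x₀ + ∫ s in (0:ℝ)..t, f (x s, y s, u s)
  snd_eq : ∀ t ∈ Icc 0 T, y t = y₀ + ∫ s in (0:ℝ)..t, g (x s, y s, u s)

section Trajectories

variable {E W : Type*} [NormedAddCommGroup E] [NormedSpace ℝ E] [FiniteDimensional ℝ E]
  [MeasurableSpace E] [BorelSpace E]
  [MetricSpace W] [MeasurableSpace W] [BorelSpace W] [SecondCountableTopology W]
  {T C : ℝ} {U : Set W} {f : E × ℝ × W → E} {g : E × ℝ × W → ℝ} {x₀ : E} {y₀ : ℝ}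

namespace IsControlledTrajectory

variable {u : ℝ → W} {x : ℝ → E} {y : ℝ → ℝ}

theorem intervalIntegrable_comp (h : IsControlledTrajectory T U f g x₀ y₀ u x y)
    (hU : IsCompact U) {G : Type*} [NormedAddCommGroup G] [SecondCountableTopology G]
    {Ψ : E × ℝ × W → G} (hΨ : Continuous Ψ) (a b : ℝ) :
    IntervalIntegrable (fun s => Ψ (x s, y s, u s)) volume a b :=
  have := FiniteDimensional.proper ℝ E
  intervalIntegrable_comp_control (Ψ := fun p : (E × ℝ) × W => Ψ (p.1.1, p.1.2, p.2))
    (by fun_prop) (h.continuous_fst.prodMk h.continuous_snd) h.measurable_control hU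
    h.control_mem a b

theorem prod_eq (h : IsControlledTrajectory T U f g x₀ y₀ u x y) (hU : IsCompact U)
    (hf : Continuous f) (hg : Continuous g) {t : ℝ} (ht : t ∈ Icc 0 T) :
    (x t, y t) = (x₀, y₀) + ∫ s in (0:ℝ)..t, (f (x s, y s, u s), g (x s, y s, u s)) := by
  have := FiniteDimensional.proper ℝ E
  have := FiniteDimensional.complete ℝ E
  rw [intervalIntegral_prodMk_s9 (h.intervalIntegrable_comp hU hf 0 t)
    (h.intervalIntegrable_comp hU hg 0 t), Prod.mk_add_mk, ← h.fst_eq t ht, ← h.snd_eq t ht]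

theorem norm_velocity_le (h : IsControlledTrajectory T U f g x₀ y₀ u x y) (hU : IsCompact U)
    (hf : Continuous f) (hg : Continuous g) (hC : 0 ≤ C)
    (hgrowth : ∀ x y u, u ∈ U → ‖f (x, y, u)‖ + |g (x, y, u)| ≤ C * (1 + ‖x‖ + |y|))
    {t : ℝ} (ht : t ∈ Icc 0 T) :
    ‖(f (x t, y t, u t), g (x t, y t, u t))‖ ≤
      2 * C * (1 + (1 + ‖(x₀, y₀)‖) * Real.exp (2 * C * T)) := by
  have h1 := norm_le_of_integral_growth (X := fun t => (x t, y t)) (C := 2 * C) (by positivity)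
    (h.continuous_fst.prodMk h.continuous_snd) (fun t ht => h.prod_eq hU hf hg ht)
    (fun s _ => norm_velocity_le_of_growth hC (hgrowth _ _ _ (h.control_mem s))) t ht
  refine (norm_velocity_le_of_growth hC (hgrowth _ _ _ (h.control_mem t))).trans ?_
  gcongr

/-- The regularized peak equation with `v = 1` has a solution along every trajectory. -/
theorem exists_regularized_peak (h : IsControlledTrajectory T U f g x₀ y₀ u x y)
    (hU : IsCompact U) (hg : Continuous g) (hT : 0 ≤ T) {A : ℝ} (hA : 0 ≤ A)
    (hgA : ∀ t ∈ Icc 0 T, |g (x t, y t, u t)| ≤ A) {θ : ℝ} (hθ : 0 ≤ θ) :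
    ∃ Z : ℝ → ℝ, Continuous Z ∧ Z 0 = y₀ ∧ ∀ t ∈ Icc 0 T, Z t = y₀ + ∫ s in (0:ℝ)..t,
      max (g (x s, y s, u s)) 0 * (1 - Real.exp (-θ * max (y s - Z s) 0)) := by
  have := FiniteDimensional.proper ℝ E
  obtain ⟨Z, hZ, hZ0, hZt⟩ := exists_caratheodory_solution
    (F := fun s z => min (max (g (x s, y s, u s)) 0) A * (1 - Real.exp (-θ * max (y s - z) 0)))
    (K := A * θ) (by positivity) hT (fun t z z' => by
      have h1 := abs_exp_neg_sub_exp_neg_le (a := θ * max (y t - z') 0)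
        (b := θ * max (y t - z) 0) (by positivity) (by positivity)
      have h2 : |max (y t - z') 0 - max (y t - z) 0| ≤ ‖z - z'‖ := by
        refine (abs_max_sub_max_le_abs _ _ _).trans_eq ?_
        rw [Real.norm_eq_abs]; congr 1; ring
      have h3 : |min (max (g (x t, y t, u t)) 0) A| ≤ A := by
        rw [abs_of_nonneg (le_min (le_max_right _ _) hA)]
        exact min_le_right _ _
      rw [← mul_sub, norm_mul, Real.norm_eq_abs, Real.norm_eq_abs, sub_sub_sub_cancel_left,
        mul_assoc]
      gcongr
      rw [← mul_sub, abs_mul, abs_of_nonneg hθ] at h1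
      simp only [neg_mul]
      exact h1.trans (by gcongr))
    (fun w hw a b => intervalIntegrable_comp_control
      (Ψ := fun p : (E × ℝ × ℝ) × W => min (max (g (p.1.1, p.1.2.1, p.2)) 0) A *
        (1 - Real.exp (-θ * max (p.1.2.1 - p.1.2.2) 0))) (by fun_prop)
      (h.continuous_fst.prodMk (h.continuous_snd.prodMk hw)) h.measurable_control hU
      h.control_mem a b) y₀
  refine ⟨Z, hZ, hZ0, fun t ht => ?_⟩
  rw [hZt t ht]
  congr 1
  refine intervalIntegral.integral_congr fun s hs => ?_
  rw [uIcc_of_le ht.1] at hs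
  have h1 := hgA s ⟨hs.1, hs.2.trans ht.2⟩
  simp only [min_eq_left (max_le ((le_abs_self _).trans h1) hA)]

end IsControlledTrajectory

/-- `z` solves `ż = max(g,0)(1 − v·e^{−θ·max(y−z,0)})` along `(u, x, y)` from `y₀` on `[0,T]`. -/
structure IsRegularizedPeak {E W : Type*} (T θ : ℝ) (g : E × ℝ × W → ℝ) (y₀ : ℝ) (u : ℝ → W)
    (v : ℝ → ℝ) (x : ℝ → E) (y z : ℝ → ℝ) : Prop where
  measurable_control : Measurable v
  control_mem : ∀ t, v t ∈ Icc (0:ℝ) 1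
  continuous : Continuous z
  zero : z 0 = y₀
  eq : ∀ t ∈ Icc 0 T, z t = y₀ + ∫ s in (0:ℝ)..t,
    max (g (x s, y s, u s)) 0 * (1 - v s * Real.exp (-θ * max (y s - z s) 0))

theorem exp_neg_mul_max_le_one {θ a : ℝ} (hθ : 0 ≤ θ) : Real.exp (-θ * max a 0) ≤ 1 :=
  Real.exp_le_one_iff.2 (by nlinarith [le_max_right a 0])

theorem one_sub_mul_exp_mem_Icc {θ v a : ℝ} (hθ : 0 ≤ θ) (hv : v ∈ Icc (0:ℝ) 1) :
    1 - v * Real.exp (-θ * max a 0) ∈ Icc (0:ℝ) 1 := by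
  have h1 := exp_neg_mul_max_le_one (a := a) hθ
  have h2 := Real.exp_pos (-θ * max a 0)
  constructor <;> nlinarith [hv.1, hv.2]

namespace IsControlledTrajectory

variable {u : ℝ → W} {v : ℝ → ℝ} {x : ℝ → E} {y z : ℝ → ℝ} {A θ : ℝ}

theorem intervalIntegrable_peak (h : IsControlledTrajectory T U f g x₀ y₀ u x y)
    (hz : IsRegularizedPeak T θ g y₀ u v x y z) (hU : IsCompact U) (hg : Continuous g) (a b : ℝ) :
    IntervalIntegrable (fun s => max (g (x s, y s, u s)) 0 *
      (1 - v s * Real.exp (-θ * max (y s - z s) 0))) volume a b :=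
  have := FiniteDimensional.proper ℝ E
  intervalIntegrable_comp_control
    (Ψ := fun p : (E × ℝ × ℝ) × (W × ℝ) => max (g (p.1.1, p.1.2.1, p.2.1)) 0 *
      (1 - p.2.2 * Real.exp (-θ * max (p.1.2.1 - p.1.2.2) 0))) (by fun_prop)
    (h.continuous_fst.prodMk (h.continuous_snd.prodMk hz.continuous))
    (h.measurable_control.prodMk hz.measurable_control) (hU.prod isCompact_Icc)
    (fun t => ⟨h.control_mem t, hz.control_mem t⟩) a b

theorem snd_sub_eq (h : IsControlledTrajectory T U f g x₀ y₀ u x y) (hU : IsCompact U)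
    (hg : Continuous g) {a b : ℝ} (ha : a ∈ Icc 0 T) (hb : b ∈ Icc 0 T) :
    y b - y a = ∫ s in a..b, g (x s, y s, u s) := by
  rw [h.snd_eq b hb, h.snd_eq a ha, add_sub_add_left_eq_sub,
    intervalIntegral.integral_interval_sub_left (h.intervalIntegrable_comp hU hg _ _)
      (h.intervalIntegrable_comp hU hg _ _)]

theorem peak_sub_eq (h : IsControlledTrajectory T U f g x₀ y₀ u x y)
    (hz : IsRegularizedPeak T θ g y₀ u v x y z) (hU : IsCompact U) (hg : Continuous g)
    {a b : ℝ} (ha : a ∈ Icc 0 T) (hb : b ∈ Icc 0 T) :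
    z b - z a = ∫ s in a..b, max (g (x s, y s, u s)) 0 *
      (1 - v s * Real.exp (-θ * max (y s - z s) 0)) := by
  rw [hz.eq b hb, hz.eq a ha, add_sub_add_left_eq_sub,
    intervalIntegral.integral_interval_sub_left (h.intervalIntegrable_peak hz hU hg _ _)
      (h.intervalIntegrable_peak hz hU hg _ _)]

theorem peak_mono (h : IsControlledTrajectory T U f g x₀ y₀ u x y)
    (hz : IsRegularizedPeak T θ g y₀ u v x y z) (hU : IsCompact U) (hg : Continuous g)
    (hθ : 0 ≤ θ) {a b : ℝ} (ha : a ∈ Icc 0 T) (hb : b ∈ Icc 0 T) (hab : a ≤ b) : z a ≤ z b := by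
  have h1 : 0 ≤ z b - z a := by
    rw [h.peak_sub_eq hz hU hg ha hb]
    exact intervalIntegral.integral_nonneg hab fun s _ =>
      mul_nonneg (le_max_right _ _) (one_sub_mul_exp_mem_Icc hθ (hz.control_mem s)).1
  linarith

/-- With `v = 1` the regularized peak never exceeds the true peak. -/
theorem peak_le_sSup (h : IsControlledTrajectory T U f g x₀ y₀ u x y)
    (hz : IsRegularizedPeak T θ g y₀ u (fun _ => 1) x y z) (hU : IsCompact U)
    (hg : Continuous g) (hT : 0 ≤ T) : z T ≤ sSup (y '' Icc 0 T) := by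
  have hbdd : BddAbove (y '' Icc 0 T) := (isCompact_Icc.image h.continuous_snd).bddAbove
  have hle : ∀ t ∈ Icc 0 T, y t ≤ sSup (y '' Icc 0 T) := fun t ht =>
    le_csSup hbdd (mem_image_of_mem y ht)
  have := le_add_of_le_add_on_superlevel (D := z) (c := sSup (y '' Icc 0 T)) (η := 0)
    hz.continuous.continuousOn (by rw [hz.zero, ← h.snd_zero]; exact hle 0 ⟨le_rfl, hT⟩) le_rfl
    (fun τ hτ t ht hgt => by
      have htI : t ∈ Icc 0 T := ⟨hτ.1.trans ht.1, ht.2⟩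
      have h0 := h.peak_sub_eq hz hU hg hτ htI
      rw [intervalIntegral.integral_congr_ae (g := fun _ => 0) (.of_forall fun s hs => by
        rw [uIoc_of_le ht.1] at hs
        have h1 := hle s ⟨hτ.1.trans hs.1.le, hs.2.trans ht.2⟩
        have h2 := hgt s hs
        simp [max_eq_right (by linarith : y s - z s ≤ 0)])] at h0
      simp only [intervalIntegral.integral_zero] at h0
      linarith) T ⟨hT, le_rfl⟩
  simpa using this

/-- The regularized peak bounds the state `y` from above up to an exponentially small error. -/
theorem le_peak_add (h : IsControlledTrajectory T U f g x₀ y₀ u x y)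
    (hz : IsRegularizedPeak T θ g y₀ u v x y z) (hU : IsCompact U) (hg : Continuous g)
    (hA : 0 ≤ A) (hgA : ∀ t ∈ Icc 0 T, |g (x t, y t, u t)| ≤ A) (hθ : 0 ≤ θ) {ε : ℝ}
    (hε : 0 ≤ ε) {t : ℝ} (ht : t ∈ Icc 0 T) :
    y t ≤ z t + (ε + A * Real.exp (-θ * ε) * T) := by
  have := le_add_of_le_add_on_superlevel (D := fun t => y t - z t) (c := ε)
    (η := A * Real.exp (-θ * ε)) (h.continuous_snd.sub hz.continuous).continuousOn
    (by simpa [h.snd_zero, hz.zero] using hε) (by positivity)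
    (fun τ hτ t ht hgt => by
      have htI : t ∈ Icc 0 T := ⟨hτ.1.trans ht.1, ht.2⟩
      have hy := h.snd_sub_eq hU hg hτ htI
      have hz' := h.peak_sub_eq hz hU hg hτ htI
      have hint := h.intervalIntegrable_comp hU hg τ t
      have hint' := h.intervalIntegrable_peak hz hU hg τ t
      have hmono : ∫ s in τ..t, (g (x s, y s, u s) - max (g (x s, y s, u s)) 0 *
          (1 - v s * Real.exp (-θ * max (y s - z s) 0)))
          ≤ ∫ s in τ..t, A * Real.exp (-θ * ε) := by
        refine intervalIntegral.integral_mono_on_of_le_Ioo ht.1 (hint.sub hint')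
          intervalIntegrable_const fun s hs => ?_
        have h1 := hgt s ⟨hs.1, hs.2.le⟩
        have h2 : Real.exp (-θ * max (y s - z s) 0) ≤ Real.exp (-θ * ε) := by
          refine Real.exp_le_exp.2 ?_
          have := le_max_left (y s - z s) 0
          nlinarith
        have h3 := (abs_le.1 (hgA s ⟨hτ.1.trans hs.1.le, hs.2.le.trans ht.2⟩)).2
        have h4 : max (g (x s, y s, u s)) 0 ≤ A := max_le h3 hA
        have h5 := hz.control_mem s
        have h6 : v s * Real.exp (-θ * max (y s - z s) 0) ≤ Real.exp (-θ * ε) :=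
          (mul_le_of_le_one_left (Real.exp_pos _).le h5.2).trans h2
        have h7 : max (g (x s, y s, u s)) 0 * (v s * Real.exp (-θ * max (y s - z s) 0)) ≤
            A * Real.exp (-θ * ε) := mul_le_mul h4 h6
          (mul_nonneg h5.1 (Real.exp_pos _).le) hA
        have h8 := le_max_left (g (x s, y s, u s)) 0
        linarith
      rw [intervalIntegral.integral_sub hint hint', ← hy, ← hz',
        intervalIntegral.integral_const, smul_eq_mul] at hmono
      linarith) t ht
  linarith

end IsControlledTrajectory

theorem IsRegularizedPeak.of_le {E W : Type*} {T θ θ' : ℝ}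
    {g : E × ℝ × W → ℝ} {y₀ : ℝ} {u : ℝ → W} {v : ℝ → ℝ} {x : ℝ → E} {y z : ℝ → ℝ}
    (hz : IsRegularizedPeak T θ' g y₀ u v x y z) (hy : Continuous y) (h : θ ≤ θ') :
    IsRegularizedPeak T θ g y₀ u
      (fun t => v t * Real.exp (-(θ' - θ) * max (y t - z t) 0)) x y z where
  measurable_control := hz.measurable_control.mul
    (by have := hz.continuous; fun_prop : Continuous fun t =>
      Real.exp (-(θ' - θ) * max (y t - z t) 0)).measurable
  control_mem t := by
    have h1 := hz.control_mem t
    have h2 := Real.exp_pos (-(θ' - θ) * max (y t - z t) 0)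
    have h3 := exp_neg_mul_max_le_one (a := y t - z t) (sub_nonneg.2 h)
    exact ⟨mul_nonneg h1.1 h2.le, mul_le_one₀ h1.2 h2.le h3⟩
  continuous := hz.continuous
  zero := hz.zero
  eq t ht := by
    rw [hz.eq t ht]
    congr 1
    refine intervalIntegral.integral_congr fun s _ => ?_
    rw [mul_assoc (v s), ← Real.exp_add]
    ring_nf

theorem lipschitzOnWith_of_eq_add_integral {S : Type*} [NormedAddCommGroup S] [NormedSpace ℝ S]
    {X G : ℝ → S} {c : S} {T : ℝ} {A : NNReal}
    (hX : ∀ t ∈ Icc 0 T, X t = c + ∫ s in (0:ℝ)..t, G s)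
    (hG : ∀ a b, IntervalIntegrable G volume a b) (hA : ∀ s ∈ Icc 0 T, ‖G s‖ ≤ A) :
    LipschitzOnWith A X (Icc 0 T) := by
  refine LipschitzOnWith.of_dist_le_mul fun a ha b hb => ?_
  rw [dist_eq_norm, hX a ha, hX b hb, add_sub_add_left_eq_sub,
    intervalIntegral.integral_interval_sub_left (hG _ _) (hG _ _)]
  exact (intervalIntegral.norm_integral_le_of_norm_le_const fun s hs =>
    hA s (uIcc_subset_Icc hb ha (uIoc_subset_uIcc hs))).trans_eq (by rw [Real.dist_eq])

theorem isClosed_setOf_epigraph {S : Type*} [TopologicalSpace S] {K : Set S} (hK : IsClosed K)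
    {φ : S → ℝ} (hφ : Continuous φ) : IsClosed {p : S × ℝ | p.1 ∈ K ∧ φ p.1 ≤ p.2} :=
  (hK.preimage continuous_fst).inter (isClosed_le (hφ.comp continuous_fst) continuous_snd)

namespace IsControlledTrajectory

variable {u : ℝ → W} {x : ℝ → E} {y : ℝ → ℝ}

theorem of_prod_eq (hUc : IsCompact U) (hf : Continuous f) (hg : Continuous g)
    (hu : Measurable u) (huU : ∀ t, u t ∈ U) (hx : Continuous x) (hy : Continuous y)
    (hx0 : x 0 = x₀) (hy0 : y 0 = y₀) (h : ∀ t ∈ Icc 0 T, (x t, y t) =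
      (x₀, y₀) + ∫ s in (0:ℝ)..t, (f (x s, y s, u s), g (x s, y s, u s))) :
    IsControlledTrajectory T U f g x₀ y₀ u x y := by
  have := FiniteDimensional.proper ℝ E
  have := FiniteDimensional.complete ℝ E
  have h' : ∀ t ∈ Icc 0 T, x t = x₀ + ∫ s in (0:ℝ)..t, f (x s, y s, u s) ∧
      y t = y₀ + ∫ s in (0:ℝ)..t, g (x s, y s, u s) := fun t ht => by
    have := h t ht
    rwa [intervalIntegral_prodMk_s9
      (intervalIntegrable_comp_control (Ψ := fun p : (E × ℝ) × W => f (p.1.1, p.1.2, p.2))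
        (by fun_prop) (hx.prodMk hy) hu hUc huU 0 t)
      (intervalIntegrable_comp_control (Ψ := fun p : (E × ℝ) × W => g (p.1.1, p.1.2, p.2))
        (by fun_prop) (hx.prodMk hy) hu hUc huU 0 t), Prod.mk_add_mk, Prod.mk.injEq] at this
  exact ⟨hu, huU, hx, hy, hx0, hy0, fun t ht => (h' t ht).1, fun t ht => (h' t ht).2⟩

end IsControlledTrajectory

theorem exists_isControlledTrajectory (hU : IsCompact U) (hUne : U.Nonempty)
    (hf : ∀ u, ContDiff ℝ 1 fun q : E × ℝ => f (q.1, q.2, u))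
    (hg : ∀ u, ContDiff ℝ 1 fun q : E × ℝ => g (q.1, q.2, u))
    (hfc : Continuous f) (hgc : Continuous g) (hC : 0 ≤ C) (hT : 0 ≤ T)
    (hgrowth : ∀ x y u, u ∈ U → ‖f (x, y, u)‖ + |g (x, y, u)| ≤ C * (1 + ‖x‖ + |y|)) :
    ∃ u x y, IsControlledTrajectory T U f g x₀ y₀ u x y := by
  obtain ⟨u, hu⟩ := hUne
  obtain ⟨q, hq, hq0, hqt⟩ := exists_solution_of_linear_growth
    (F := fun q : E × ℝ => (f (q.1, q.2, u), g (q.1, q.2, u))) ((hf u).prodMk (hg u))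
    (C := 2 * C) (by positivity) hT
    (fun q => norm_velocity_le_of_growth hC (hgrowth _ _ u hu)) (x₀, y₀)
  exact ⟨fun _ => u, fun t => (q t).1, fun t => (q t).2,
    .of_prod_eq hU hfc hgc measurable_const (fun _ => hu) hq.fst hq.snd (by simp [hq0])
      (by simp [hq0]) hqt⟩

theorem IsControlledTrajectory.exists_isRegularizedPeak {u : ℝ → W} {x : ℝ → E} {y : ℝ → ℝ}
    (h : IsControlledTrajectory T U f g x₀ y₀ u x y) (hU : IsCompact U)
    (hf : Continuous f) (hg : Continuous g) (hC : 0 ≤ C) (hT : 0 ≤ T)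
    (hgrowth : ∀ x y u, u ∈ U → ‖f (x, y, u)‖ + |g (x, y, u)| ≤ C * (1 + ‖x‖ + |y|))
    {θ : ℝ} (hθ : 0 ≤ θ) : ∃ z, IsRegularizedPeak T θ g y₀ u (fun _ => 1) x y z := by
  obtain ⟨z, hz, hz0, hzt⟩ := h.exists_regularized_peak hU hg hT
    (A := 2 * C * (1 + (1 + ‖(x₀, y₀)‖) * Real.exp (2 * C * T))) (by positivity)
    (fun t ht => (norm_snd_le _).trans (h.norm_velocity_le hU hf hg hC hgrowth ht)) hθ
  exact ⟨z, measurable_const, fun _ => ⟨zero_le_one, le_rfl⟩, hz, hz0, by simpa using hzt⟩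

/-- Every limit of terminal regularized peaks is bounded below by one of a trajectory with
`v = 1`. -/
theorem exists_isRegularizedPeak_le_of_tendsto (hU : IsCompact U) (hUne : U.Nonempty)
    (hf : Continuous f) (hg : Continuous g) (hC : 0 ≤ C) (hT : 0 ≤ T)
    (hgrowth : ∀ x y u, u ∈ U → ‖f (x, y, u)‖ + |g (x, y, u)| ≤ C * (1 + ‖x‖ + |y|))
    (hconv : ∀ x y, Convex ℝ ((fun u => (f (x, y, u), g (x, y, u))) '' U)) {θ : ℝ} (hθ : 0 ≤ θ)
    {u : ℕ → ℝ → W} {v : ℕ → ℝ → ℝ} {x : ℕ → ℝ → E} {y z : ℕ → ℝ → ℝ}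
    (htraj : ∀ k, IsControlledTrajectory T U f g x₀ y₀ (u k) (x k) (y k))
    (hpeak : ∀ k, IsRegularizedPeak T θ g y₀ (u k) (v k) (x k) (y k) (z k))
    {r : ℝ} (hr : Tendsto (fun k => z k T) atTop (𝓝 r)) :
    ∃ u x y z, IsControlledTrajectory T U f g x₀ y₀ u x y ∧
      IsRegularizedPeak T θ g y₀ u (fun _ => 1) x y z ∧ z T ≤ r := by
  have := FiniteDimensional.proper ℝ E
  have := FiniteDimensional.complete ℝ E
  let A : NNReal := ⟨2 * C * (1 + (1 + ‖(x₀, y₀)‖) * Real.exp (2 * C * T)), by positivity⟩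
  let Φ : (E × ℝ) × W → E × ℝ := fun p => (f (p.1.1, p.1.2, p.2), g (p.1.1, p.1.2, p.2))
  have hΦ : Continuous Φ := by fun_prop
  let Ψ : ((E × ℝ) × ℝ) × (W × ℝ) → (E × ℝ) × ℝ := fun p =>
    (Φ (p.1.1, p.2.1), max (g (p.1.1.1, p.1.1.2, p.2.1)) 0 *
      (1 - p.2.2 * Real.exp (-θ * max (p.1.1.2 - p.1.2) 0)))
  have hΨ : Continuous Ψ := by fun_prop
  let q : ℕ → ℝ → (E × ℝ) × ℝ := fun k t => ((x k t, y k t), z k t)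
  let w : ℕ → ℝ → W × ℝ := fun k t => (u k t, v k t)
  have hq : ∀ k, Continuous (q k) := fun k =>
    ((htraj k).continuous_fst.prodMk (htraj k).continuous_snd).prodMk (hpeak k).continuous
  have hw : ∀ k, Measurable (w k) := fun k =>
    (htraj k).measurable_control.prodMk (hpeak k).measurable_control
  have hwV : ∀ k t, w k t ∈ U ×ˢ Icc (0:ℝ) 1 := fun k t =>
    ⟨(htraj k).control_mem t, (hpeak k).control_mem t⟩
  have hV : IsCompact (U ×ˢ Icc (0:ℝ) 1) := hU.prod isCompact_Icc
  have hqt : ∀ k, ∀ t ∈ Icc 0 T,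
      q k t = ((x₀, y₀), y₀) + ∫ s in (0:ℝ)..t, Ψ (q k s, w k s) := fun k t ht => by
    have h1 := intervalIntegral_prodMk_s9
      ((htraj k).intervalIntegrable_comp hU (Ψ := fun p => (f p, g p)) (by fun_prop) 0 t)
      ((htraj k).intervalIntegrable_peak (hpeak k) hU hg 0 t)
    have h2 := (htraj k).prod_eq hU hf hg ht
    have h3 := (hpeak k).eq t ht
    simp only [q, w, Ψ, Φ]
    rw [h1, Prod.mk_add_mk, ← h2, ← h3]
  have hvel : ∀ k, ∀ s ∈ Icc 0 T, ‖Ψ (q k s, w k s)‖ ≤ A := fun k s hs => by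
    have h1 := (htraj k).norm_velocity_le hU hf hg hC hgrowth hs
    refine max_le h1 ?_
    have h2 := one_sub_mul_exp_mem_Icc (a := y k s - z k s) hθ ((hpeak k).control_mem s)
    have h3 : |max (g (x k s, y k s, u k s)) 0| ≤ |g (x k s, y k s, u k s)| := by
      rw [abs_of_nonneg (le_max_right _ _)]
      exact max_le (le_abs_self _) (abs_nonneg _)
    refine le_trans ?_ ((norm_snd_le _).trans h1)
    simp only [Ψ, q, w]
    rw [norm_mul, Real.norm_eq_abs, Real.norm_eq_abs, abs_of_nonneg h2.1]
    exact (mul_le_of_le_one_right (abs_nonneg _) h2.2).trans h3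
  have hLip : ∀ k, LipschitzOnWith A (q k) (Icc 0 T) := fun k =>
    lipschitzOnWith_of_eq_add_integral (hqt k)
      (intervalIntegrable_comp_control hΨ (hq k) (hw k) hV (hwV k)) (hvel k)
  have hq0 : ∀ k, q k 0 = ((x₀, y₀), y₀) := fun k => by
    simp [q, (htraj k).fst_zero, (htraj k).snd_zero, (hpeak k).zero]
  have h0 : (0:ℝ) ∈ Icc 0 T := ⟨le_rfl, hT⟩
  obtain ⟨Q, hQL, hQ⟩ := exists_lipschitz_hyperfilter_limit hT hLip
    (isCompact_closedBall ((x₀, y₀), y₀) (A * T)) fun k t ht => by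
      rw [Metric.mem_closedBall, ← hq0 k]
      refine ((hLip k).dist_le_mul t ht 0 h0).trans ?_
      gcongr
      rw [Real.dist_eq, sub_zero, abs_of_nonneg ht.1]
      exact ht.2
  have hQc := hQL.continuous
  have hQ0 : Q 0 = ((x₀, y₀), y₀) :=
    tendsto_nhds_unique (hQ 0 h0) (tendsto_const_nhds.congr fun k => (hq0 k).symm)
  have hQT : (Q T).2 = r := tendsto_nhds_unique ((hQ T ⟨hT, le_rfl⟩).snd_nhds)
    (hr.mono_left Nat.hyperfilter_le_atTop)
  have hae : ∀ᵐ t, t ∈ Ioo 0 T → HasDerivAt Q (deriv Q t) t ∧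
      (∃ w ∈ U, Φ ((Q t).1, w) = (deriv Q t).1) ∧
      max (deriv Q t).1.2 0 * (1 - Real.exp (-θ * max ((Q t).1.2 - (Q t).2) 0)) ≤
        (deriv Q t).2 := by
    filter_upwards [hQL.ae_differentiableAt] with t hdiff ht
    refine ⟨hdiff.hasDerivAt, ?_⟩
    have hc := (one_sub_mul_exp_mem_Icc (v := 1) (a := (Q t).1.2 - (Q t).2) hθ
      ⟨zero_le_one, le_rfl⟩).1
    rw [one_mul] at hc
    set c := 1 - Real.exp (-θ * max ((Q t).1.2 - (Q t).2) 0) with hcdef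
    have hK : IsClosed ((fun w => Φ ((Q t).1, w)) '' U) :=
      (hU.image (by fun_prop)).isClosed
    refine deriv_mem_of_limit_trajectories hΨ hV hq hw hwV hqt hLip hQ ht hdiff.hasDerivAt
      (P := {p | p.1 ∈ (fun w => Φ ((Q t).1, w)) '' U ∧ max p.1.2 0 * c ≤ p.2})
      (isClosed_setOf_epigraph hK (φ := fun s => max s.2 0 * c) (by fun_prop)) ?_ ?_
    · have hmax : ConvexOn ℝ univ fun s : E × ℝ => max s.2 0 * c := by
        have h1 : ConvexOn ℝ univ fun s : E × ℝ => s.2 :=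
          (LinearMap.snd ℝ E ℝ).convexOn convex_univ
        simpa [mul_comm] using (h1.sup (convexOn_const 0 convex_univ)).smul hc
      exact (hmax.subset (subset_univ _) (hconv (Q t).1.1 (Q t).1.2)).convex_epigraph
    · rintro ⟨a, b⟩ ⟨ha, hb⟩
      refine ⟨⟨a, ha, rfl⟩, ?_⟩
      simp only [Ψ, Φ, hcdef]
      gcongr
      exact mul_le_of_le_one_left (Real.exp_pos _).le hb.2
  obtain ⟨ū, hū, hmin⟩ := exists_measurable_argmin hU hUne
    (h := fun t w => ‖Φ ((Q t).1, w) - (deriv Q t).1‖)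
    (fun w => ((by fun_prop : Continuous fun t => Φ ((Q t).1, w)).measurable.sub
      (measurable_deriv Q).fst).norm)
    (fun t => by fun_prop)
  have hsel : ∀ᵐ t, t ∈ Ioo 0 T → HasDerivAt Q (deriv Q t) t ∧
      Φ ((Q t).1, ū t) = (deriv Q t).1 ∧
      max (deriv Q t).1.2 0 * (1 - Real.exp (-θ * max ((Q t).1.2 - (Q t).2) 0)) ≤
        (deriv Q t).2 := by
    filter_upwards [hae] with t ht htI
    obtain ⟨h1, ⟨a, ha, hEq⟩, h2⟩ := ht htI
    have h3 := (hmin t).2 a ha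
    rw [hEq, sub_self, norm_zero] at h3
    exact ⟨h1, sub_eq_zero.1 (norm_le_zero_iff.1 h3), h2⟩
  obtain ⟨M, hM⟩ := ((isCompact_Icc (a := (0:ℝ)) (b := T)).image hQc.fst |>.prod
    hU).exists_bound_of_continuousOn hΦ.continuousOn
  have hQ1 := eq_add_integral_of_ae_hasDerivAt (X := fun t => (Q t).1)
    (G := fun t => Φ ((Q t).1, ū t)) (M := M.toNNReal) (LipschitzWith.prod_fst.comp hQL)
    (intervalIntegrable_comp_control hΦ hQc.fst hū hU fun t => (hmin t).1)
    (fun s hs => (hM (_, ū s) ⟨mem_image_of_mem _ hs, (hmin s).1⟩).trans (Real.le_coe_toNNReal M))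
    (by
      filter_upwards [hsel] with t ht htI
      rw [(ht htI).2.1]
      exact (ht htI).1.fst)
  have hX : IsControlledTrajectory T U f g x₀ y₀ ū (fun t => (Q t).1.1) (fun t => (Q t).1.2) :=
    .of_prod_eq hU hf hg hū (fun t => (hmin t).1) hQc.fst.fst hQc.fst.snd (by simp [hQ0])
      (by simp [hQ0]) (by simpa only [hQ0] using hQ1)
  obtain ⟨Z, hZ⟩ := hX.exists_isRegularizedPeak hU hf hg hC hT hgrowth hθ
  refine ⟨ū, _, _, Z, hX, hZ, ?_⟩
  have hcmp := le_add_of_le_add_on_superlevel (D := fun t => Z t - (Q t).2) (T := T) (c := 0)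
    (η := 0) (hZ.continuous.sub hQc.snd).continuousOn (by simp [hZ.zero, hQ0]) le_rfl
    (fun τ hτ t ht hgt => by
      have htI : t ∈ Icc 0 T := ⟨hτ.1.trans ht.1, ht.2⟩
      have hac : AbsolutelyContinuousOnInterval (fun t => (Q t).2) τ t :=
        ((LipschitzWith.prod_snd.comp hQL).lipschitzOnWith
          (s := uIcc τ t)).absolutelyContinuousOnInterval
      have h1 := hac.integral_deriv_eq_sub
      have h2 := hX.peak_sub_eq hZ hU hg hτ htI
      have h3 := intervalIntegral.integral_mono_ae_restrict ht.1
        (hX.intervalIntegrable_peak hZ hU hg τ t) hac.intervalIntegrable_deriv (by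
          rw [← restrict_Ioo_eq_restrict_Icc]
          filter_upwards [ae_restrict_mem measurableSet_Ioo, ae_restrict_of_ae hsel] with s hs hs'
          obtain ⟨hd, hEq, hle⟩ := hs' ⟨hτ.1.trans_lt hs.1, hs.2.trans_le ht.2⟩
          have hd2 : HasDerivAt (fun t => (Q t).2) (deriv Q s).2 s := hd.snd
          rw [hd2.deriv]
          refine le_trans ?_ hle
          have h4 := congrArg Prod.snd hEq
          simp only [Φ] at h4
          rw [one_mul, h4]
          have h5 := hgt s ⟨hs.1, hs.2.le⟩
          gcongr ?_ * (1 - ?_)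
          refine Real.exp_le_exp.2 ?_
          rw [neg_mul, neg_mul, neg_le_neg_iff]
          gcongr
          linarith)
      rw [h1, ← h2] at h3
      linarith) T ⟨hT, le_rfl⟩
  simp only [hQT] at hcmp
  linarith

end Trajectories

section Values

variable {n p : ℕ} {T C θ r : ℝ} {U : Set (EuclideanSpace ℝ (Fin p))}
  {f : EuclideanSpace ℝ (Fin n) × ℝ × EuclideanSpace ℝ (Fin p) → EuclideanSpace ℝ (Fin n)}
  {g : EuclideanSpace ℝ (Fin n) × ℝ × EuclideanSpace ℝ (Fin p) → ℝ}
  {x₀ : EuclideanSpace ℝ (Fin n)} {y₀ : ℝ}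

theorem mem_valuesP_iff : r ∈ valuesP n p T U f g x₀ y₀ ↔
    ∃ u x y, IsControlledTrajectory T U f g x₀ y₀ u x y ∧ r = sSup (y '' Icc 0 T) :=
  ⟨fun ⟨u, x, y, h1, h2, h3, h4, h5, h6, h7, h8, h9⟩ =>
    ⟨u, x, y, ⟨h1, h2, h3, h4, h5, h6, h7, h8⟩, h9⟩,
  fun ⟨u, x, y, ⟨h1, h2, h3, h4, h5, h6, h7, h8⟩, h9⟩ =>
    ⟨u, x, y, h1, h2, h3, h4, h5, h6, h7, h8, h9⟩⟩

theorem mem_valuesP3theta_iff : r ∈ valuesP3theta n p T U f g x₀ y₀ θ ↔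
    ∃ u v x y z, IsControlledTrajectory T U f g x₀ y₀ u x y ∧
      IsRegularizedPeak T θ g y₀ u v x y z ∧ r = z T :=
  ⟨fun ⟨u, v, x, y, z, h1, h2, h3, h4, h5, h6, h7, h8, h9, h10, h11, h12, h13, h14⟩ =>
    ⟨u, v, x, y, z, ⟨h1, h2, h5, h6, h8, h9, h11, h12⟩, ⟨h3, h4, h7, h10, h13⟩, h14⟩,
  fun ⟨u, v, x, y, z, ⟨h1, h2, h5, h6, h8, h9, h11, h12⟩, ⟨h3, h4, h7, h10, h13⟩, h14⟩ =>
    ⟨u, v, x, y, z, h1, h2, h3, h4, h5, h6, h7, h8, h9, h10, h11, h12, h13, h14⟩⟩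

theorem valuesP3theta_anti {θ' : ℝ} (h : θ ≤ θ') :
    valuesP3theta n p T U f g x₀ y₀ θ' ⊆ valuesP3theta n p T U f g x₀ y₀ θ := fun r hr => by
  obtain ⟨u, v, x, y, z, hx, hz, rfl⟩ := mem_valuesP3theta_iff.1 hr
  exact mem_valuesP3theta_iff.2 ⟨u, _, x, y, z, hx, hz.of_le hx.continuous_snd h, rfl⟩

theorem bddBelow_valuesP (hT : 0 ≤ T) : BddBelow (valuesP n p T U f g x₀ y₀) := by
  refine ⟨y₀, fun r hr => ?_⟩
  obtain ⟨u, x, y, h, rfl⟩ := mem_valuesP_iff.1 hr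
  exact le_csSup (isCompact_Icc.image h.continuous_snd).bddAbove ⟨0, ⟨le_rfl, hT⟩, h.snd_zero⟩

theorem bddBelow_valuesP3theta (hU : IsCompact U) (hg : Continuous g) (hT : 0 ≤ T)
    (hθ : 0 ≤ θ) : BddBelow (valuesP3theta n p T U f g x₀ y₀ θ) := by
  refine ⟨y₀, fun r hr => ?_⟩
  obtain ⟨u, v, x, y, z, h, hz, rfl⟩ := mem_valuesP3theta_iff.1 hr
  rw [← hz.zero]
  exact h.peak_mono hz hU hg hθ ⟨le_rfl, hT⟩ ⟨hT, le_rfl⟩ hT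

end Values

end Helpers

/-- value-convergence content of Proposition 5 of the paper:
under convexity of the velocity set, for every `θ > 0` the infimum `V_θ` of the
regularized problem `P₃^θ` is attained; `θ ↦ V_θ` is nondecreasing on `(0,∞)`;
`V_θ ≤ V` for all `θ > 0`, where `V` is the value of problem `P`; and
`V_θ → V` as `θ → +∞`. -/
theorem stmt9 (n p : ℕ) (T : ℝ) (hT : 0 < T)
    (U : Set (EuclideanSpace ℝ (Fin p))) (hUne : U.Nonempty) (hUcomp : IsCompact U)
    (f : EuclideanSpace ℝ (Fin n) × ℝ × EuclideanSpace ℝ (Fin p) → EuclideanSpace ℝ (Fin n))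
    (g : EuclideanSpace ℝ (Fin n) × ℝ × EuclideanSpace ℝ (Fin p) → ℝ)
    (hf : ContDiff ℝ 1 f) (hg : ContDiff ℝ 1 g)
    (C : ℝ) (hC : 0 < C)
    (hgrowth : ∀ x y u, u ∈ U → ‖f (x, y, u)‖ + |g (x, y, u)| ≤ C * (1 + ‖x‖ + |y|))
    (hconv : ∀ x y, Convex ℝ ((fun u => (f (x, y, u), g (x, y, u))) '' U))
    (x₀ : EuclideanSpace ℝ (Fin n)) (y₀ : ℝ) :
    (∀ θ : ℝ, 0 < θ →
      sInf (valuesP3theta n p T U f g x₀ y₀ θ) ∈ valuesP3theta n p T U f g x₀ y₀ θ) ∧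
    (∀ θ θ' : ℝ, 0 < θ → θ ≤ θ' →
      sInf (valuesP3theta n p T U f g x₀ y₀ θ) ≤ sInf (valuesP3theta n p T U f g x₀ y₀ θ')) ∧
    (∀ θ : ℝ, 0 < θ →
      sInf (valuesP3theta n p T U f g x₀ y₀ θ) ≤ sInf (valuesP n p T U f g x₀ y₀)) ∧
    Filter.Tendsto (fun θ => sInf (valuesP3theta n p T U f g x₀ y₀ θ)) Filter.atTop
      (nhds (sInf (valuesP n p T U f g x₀ y₀))) := by
  have hfc := hf.continuous
  have hgc := hg.continuous
  have hT' := hT.le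
  obtain ⟨u₁, x₁, y₁, h₁⟩ := exists_isControlledTrajectory (x₀ := x₀) (y₀ := y₀) hUcomp hUne
    (fun u => hf.comp (by fun_prop)) (fun u => hg.comp (by fun_prop)) hfc hgc hC.le hT' hgrowth
  have hPne : (valuesP n p T U f g x₀ y₀).Nonempty :=
    ⟨_, mem_valuesP_iff.2 ⟨u₁, x₁, y₁, h₁, rfl⟩⟩
  have hne : ∀ θ : ℝ, 0 ≤ θ → (valuesP3theta n p T U f g x₀ y₀ θ).Nonempty := fun θ hθ => by
    obtain ⟨z, hz⟩ := h₁.exists_isRegularizedPeak hUcomp hfc hgc hC.le hT' hgrowth hθ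
    exact ⟨_, mem_valuesP3theta_iff.2 ⟨u₁, _, x₁, y₁, z, h₁, hz, rfl⟩⟩
  have hbdd : ∀ θ : ℝ, 0 ≤ θ → BddBelow (valuesP3theta n p T U f g x₀ y₀ θ) := fun θ hθ =>
    bddBelow_valuesP3theta hUcomp hgc hT' hθ
  have hle : ∀ θ : ℝ, 0 < θ →
      sInf (valuesP3theta n p T U f g x₀ y₀ θ) ≤ sInf (valuesP n p T U f g x₀ y₀) := by
    refine fun θ hθ => le_csInf hPne fun r hr => ?_
    obtain ⟨u, x, y, h, rfl⟩ := mem_valuesP_iff.1 hr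
    obtain ⟨z, hz⟩ := h.exists_isRegularizedPeak hUcomp hfc hgc hC.le hT' hgrowth hθ.le
    exact (csInf_le (hbdd θ hθ.le) (mem_valuesP3theta_iff.2 ⟨u, _, x, y, z, h, hz, rfl⟩)).trans
      (h.peak_le_sSup hz hUcomp hgc hT')
  refine ⟨fun θ hθ => ?_, fun θ θ' hθ h => ?_, hle, ?_⟩
  · obtain ⟨s, -, hs, hmem⟩ := exists_seq_tendsto_sInf (hne θ hθ.le) (hbdd θ hθ.le)
    choose u v x y z htraj hpeak hval using fun k => mem_valuesP3theta_iff.1 (hmem k)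
    obtain ⟨u', x', y', z', h', hz', hle'⟩ := exists_isRegularizedPeak_le_of_tendsto hUcomp hUne
      hfc hgc hC.le hT' hgrowth hconv hθ.le htraj hpeak (hs.congr hval)
    have hz'mem := mem_valuesP3theta_iff.2 ⟨u', _, x', y', z', h', hz', rfl⟩
    rwa [← hle'.antisymm (csInf_le (hbdd θ hθ.le) hz'mem)]
  · exact csInf_le_csInf (hbdd θ hθ.le) (hne θ' (hθ.le.trans h)) (valuesP3theta_anti h)
  · set A : ℝ := 2 * C * (1 + (1 + ‖(x₀, y₀)‖) * Real.exp (2 * C * T))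
    have hA : 0 ≤ A := by positivity
    have hge : ∀ θ : ℝ, 0 < θ → ∀ ε : ℝ, 0 ≤ ε → sInf (valuesP n p T U f g x₀ y₀) -
        (ε + A * Real.exp (-θ * ε) * T) ≤ sInf (valuesP3theta n p T U f g x₀ y₀ θ) := by
      refine fun θ hθ ε hε => le_csInf (hne θ hθ.le) fun r hr => ?_
      obtain ⟨u, v, x, y, z, h, hz, rfl⟩ := mem_valuesP3theta_iff.1 hr
      rw [sub_le_iff_le_add]
      refine (csInf_le (bddBelow_valuesP hT') (mem_valuesP_iff.2 ⟨u, x, y, h, rfl⟩)).trans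
        (csSup_le ((nonempty_Icc.2 hT').image y) ?_)
      rintro _ ⟨t, ht, rfl⟩
      have h2 := h.le_peak_add hz hUcomp hgc hA (fun t ht => (norm_snd_le _).trans
        (h.norm_velocity_le hUcomp hfc hgc hC.le hgrowth ht)) hθ.le hε ht
      have h3 := h.peak_mono hz hUcomp hgc hθ.le ht ⟨hT', le_rfl⟩ ht.2
      linarith
    refine tendsto_order.2 ⟨fun a ha => ?_, fun a ha => ?_⟩
    · obtain ⟨ε, hε, hε'⟩ : ∃ ε : ℝ, 0 < ε ∧ a < sInf (valuesP n p T U f g x₀ y₀) - ε :=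
        ⟨(sInf (valuesP n p T U f g x₀ y₀) - a) / 2, by linarith, by linarith⟩
      have hlim : Filter.Tendsto (fun θ : ℝ => sInf (valuesP n p T U f g x₀ y₀) -
          (ε + A * Real.exp (-θ * ε) * T)) Filter.atTop
          (nhds (sInf (valuesP n p T U f g x₀ y₀) - (ε + A * 0 * T))) := by
        have : Filter.Tendsto (fun θ : ℝ => Real.exp (-θ * ε)) Filter.atTop (nhds 0) :=
          Real.tendsto_exp_atBot.comp
            (Filter.tendsto_neg_atTop_atBot.atBot_mul_const hε)
        exact tendsto_const_nhds.sub (tendsto_const_nhds.add ((this.const_mul A).mul_const T))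
      filter_upwards [hlim.eventually_const_lt (by simpa using hε'), Filter.eventually_gt_atTop 0]
        with θ h1 h2
      exact h1.trans_le (hge θ h2 ε hε.le)
    · filter_upwards [Filter.eventually_gt_atTop 0] with θ hθ
      exact (hle θ hθ).trans_lt ha
end
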